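/- arXiv:0801.2525 — 3 statements merged into one kernel-verified Lean document; each statement's English description precedes it below -/
import Mathlib

section
/- Let V be a finite set, let p : V → ℝ² be a generic configuration (the 2|V| coordinates of p are algebraically independent over ℚ), and let E be a set of edges (2-element subsets of V). Then the rigidity-matrix rows of the edges of E are linearly independent in (ℝ²)^V if and only if E satisfies Laman's condition: every nonempty subset F ⊆ E satisfies |F| ≤ 2|V(F)| − 3, where V(F) is the set of endpoints of edges of F. -/
/-- The two-element set of endpoints of an edge (an unordered pair of vertices). -/
def sym2Verts {V : Type*} [DecidableEq V] (e : Sym2 V) : Finset V :=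
  Sym2.lift ⟨fun a b => {a, b}, fun a b => Finset.pair_comm a b⟩ e

/-- The set `V(F)` of endpoints of the edges of a finite edge set `F`. -/
def edgeVerts {V : Type*} [DecidableEq V] (F : Finset (Sym2 V)) : Finset V :=
  F.sup sym2Verts

/-- Laman's condition: every nonempty subset `F'` of the edge set `F`
satisfies `|F'| ≤ 2|V(F')| - 3`. -/
def Laman {V : Type*} [DecidableEq V] (F : Finset (Sym2 V)) : Prop :=
  ∀ F' ⊆ F, F'.Nonempty → F'.card ≤ 2 * (edgeVerts F').card - 3

/-- The row of the rigidity matrix corresponding to an edge `{i,j}`: the vector in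
`(ℝ²)^V` whose entry at `i` is `p i - p j`, at `j` is `p j - p i`, and `0` elsewhere. -/
def rigRow {V : Type*} [DecidableEq V] (p : V → ℝ × ℝ) (e : Sym2 V) : V → ℝ × ℝ :=
  Sym2.lift ⟨fun i j v => (if v = i then p i - p j else 0) + (if v = j then p j - p i else 0),
    fun _ _ => funext fun _ => add_comm _ _⟩ e

/-- The family of all `2|V|` coordinates of a configuration `p : V → ℝ²`. -/
def coords {V : Type*} (p : V → ℝ × ℝ) : V × Fin 2 → ℝ :=
  fun x => if x.2 = 0 then (p x.1).1 else (p x.1).2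

namespace LamanAux

open Finset

/-- rigidity row over an arbitrary ring -/
def row {V R : Type*} [DecidableEq V] [CommRing R] (c : V × Fin 2 → R) (e : Sym2 V)
    (x : V × Fin 2) : R :=
  Sym2.lift ⟨fun i j => (if x.1 = i then c (i, x.2) - c (j, x.2) else 0)
      + (if x.1 = j then c (j, x.2) - c (i, x.2) else 0), fun _ _ => add_comm _ _⟩ e

section
variable {V : Type*} [DecidableEq V]

lemma row_mk {R : Type*} [CommRing R] (c : V × Fin 2 → R) (i j : V) (x : V × Fin 2) :
    row c s(i, j) x = (if x.1 = i then c (i, x.2) - c (j, x.2) else 0)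
      + (if x.1 = j then c (j, x.2) - c (i, x.2) else 0) := rfl

lemma verts_mk (i j : V) : sym2Verts s(i, j) = {i, j} := rfl

lemma mem_verts (e : Sym2 V) (v : V) : v ∈ sym2Verts e ↔ v ∈ e := by
  induction e using Sym2.ind with
  | _ i j => simp [verts_mk]

lemma card_verts (e : Sym2 V) (h : ¬ e.IsDiag) : (sym2Verts e).card = 2 := by
  induction e using Sym2.ind with
  | _ i j => rw [verts_mk]; exact Finset.card_pair (by simpa using h)

lemma row_map {R S : Type*} [CommRing R] [CommRing S] (f : R →+* S) (c : V × Fin 2 → R)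
    (e : Sym2 V) (x : V × Fin 2) : f (row c e x) = row (fun y => f (c y)) e x := by
  induction e using Sym2.ind with
  | _ i j => simp only [row_mk, map_add, apply_ite f, map_sub, map_zero]

lemma row_zero {R : Type*} [CommRing R] (c : V × Fin 2 → R) (e : Sym2 V) (x : V × Fin 2)
    (h : x.1 ∉ sym2Verts e) : row c e x = 0 := by
  induction e using Sym2.ind with
  | _ i j =>
    simp only [verts_mk, mem_insert, mem_singleton, not_or] at h
    simp [row_mk, h.1, h.2]

lemma row_congr {R : Type*} [CommRing R] (c c' : V × Fin 2 → R) (e : Sym2 V) (x : V × Fin 2)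
    (h : ∀ v ∈ sym2Verts e, ∀ k, c (v, k) = c' (v, k)) : row c e x = row c' e x := by
  induction e using Sym2.ind with
  | _ i j =>
    simp only [verts_mk, mem_insert, mem_singleton, forall_eq_or_imp, forall_eq] at h
    simp [row_mk, h.1, h.2]

/-- linear independence of rows in coordinates -/
def Ind (c : V × Fin 2 → ℝ) (F : Finset (Sym2 V)) : Prop :=
  ∀ l : Sym2 V → ℝ, (∀ x, ∑ e ∈ F, l e * row c e x = 0) → ∀ e ∈ F, l e = 0

lemma rigRow_coords (p : V → ℝ × ℝ) (e : Sym2 V) (v : V) :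
    rigRow p e v = (row (coords p) e (v, 0), row (coords p) e (v, 1)) := by
  induction e using Sym2.ind with
  | _ i j =>
    have : rigRow p s(i, j) v =
      (if v = i then p i - p j else 0) + (if v = j then p j - p i else 0) := rfl
    rw [this, row_mk, row_mk]
    simp only [coords]
    ext <;> split_ifs <;> simp_all

lemma ind_iff (p : V → ℝ × ℝ) (E : Finset (Sym2 V)) :
    LinearIndependent ℝ (fun e : E => rigRow p e.1) ↔ Ind (coords p) E := by
  have h := linearIndepOn_finset_iff (R := ℝ) (v := rigRow p) (s := E)
  refine h.trans ?_
  unfold Ind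
  refine forall_congr' fun l => ?_
  refine imp_congr ?_ Iff.rfl
  constructor
  · intro h x
    have h1 := congrFun h x.1
    simp only [Finset.sum_apply, Pi.smul_apply, rigRow_coords, Pi.zero_apply] at h1
    rcases x with ⟨v, k⟩
    have h2 := congrArg Prod.fst h1
    have h3 := congrArg Prod.snd h1
    simp only [Prod.fst_sum, Prod.snd_sum, Prod.smul_mk, smul_eq_mul, Prod.fst_zero,
      Prod.snd_zero] at h2 h3
    fin_cases k
    · exact h2
    · exact h3
  · intro h
    funext v
    simp only [Finset.sum_apply, Pi.smul_apply, rigRow_coords, Pi.zero_apply]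
    ext
    · simpa [Prod.fst_sum] using h (v, 0)
    · simpa [Prod.snd_sum] using h (v, 1)

lemma Ind.mono {c : V × Fin 2 → ℝ} {F G : Finset (Sym2 V)} (h : Ind c G) (hs : F ⊆ G) :
    Ind c F := by
  intro l hl e he
  have := h (fun e => if e ∈ F then l e else 0) (by
    intro x
    refine Eq.trans ?_ (hl x)
    symm
    rw [← Finset.sum_subset hs]
    · exact Finset.sum_congr rfl fun e he => by simp [he]
    · intro e _ he; simp [he]) e (hs he)
  simpa [he] using this

/-- Gram matrix -/
def gram {R : Type*} [CommRing R] [Fintype V] (c : V × Fin 2 → R) (F : Finset (Sym2 V)) :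
    Matrix F F R :=
  Matrix.of fun e f => ∑ x, row c e.1 x * row c f.1 x

lemma ind_of_gram [Fintype V] (c : V × Fin 2 → ℝ) (F : Finset (Sym2 V))
    (h : (gram c F).det ≠ 0) : Ind c F := by
  intro l hl
  by_contra! hne
  obtain ⟨e, he, hle⟩ := hne
  apply h
  rw [← Matrix.exists_vecMul_eq_zero_iff]
  refine ⟨fun e => l e.1, fun h0 => hle (congrFun h0 ⟨e, he⟩), ?_⟩
  funext f
  simp only [Matrix.vecMul, dotProduct, gram, Matrix.of_apply, Finset.mul_sum, Pi.zero_apply]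
  rw [Finset.sum_comm]
  refine Finset.sum_eq_zero fun x _ => ?_
  have := hl x
  rw [← Finset.sum_coe_sort] at this
  calc ∑ e : F, l e.1 * (row c e.1 x * row c f.1 x)
      = (∑ e : F, l e.1 * row c e.1 x) * row c f.1 x := by
        rw [Finset.sum_mul]; exact Finset.sum_congr rfl fun _ _ => by ring
    _ = 0 := by rw [this, zero_mul]

lemma gram_of_ind [Fintype V] (c : V × Fin 2 → ℝ) (F : Finset (Sym2 V))
    (h : Ind c F) : (gram c F).det ≠ 0 := by
  intro h0
  rw [← Matrix.exists_vecMul_eq_zero_iff] at h0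
  obtain ⟨w, hw, hw0⟩ := h0
  apply hw
  let l : Sym2 V → ℝ := fun e => if he : e ∈ F then w ⟨e, he⟩ else 0
  have hlw : ∀ e : F, l e.1 = w e := fun e => by simp [l]
  have key : ∀ x, ∑ e : F, w e * row c e.1 x = 0 := by
    have hs : ∑ x, (∑ e : F, w e * row c e.1 x) ^ 2 = 0 := by
      have : ∑ f : F, (Matrix.vecMul w (gram c F)) f * w f = 0 := by simp [hw0]
      rw [← this]
      simp only [Matrix.vecMul, dotProduct, gram, Matrix.of_apply, Finset.mul_sum,
        Finset.sum_mul, sq]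
      rw [Finset.sum_comm]
      refine Finset.sum_congr rfl fun f _ => ?_
      rw [Finset.sum_comm]
      exact Finset.sum_congr rfl fun f _ => Finset.sum_congr rfl fun x _ => by ring
    rw [Finset.sum_eq_zero_iff_of_nonneg (fun _ _ => sq_nonneg _)] at hs
    intro x
    exact pow_eq_zero_iff (two_ne_zero) |>.1 (hs x (mem_univ _))
  have := h l (fun x => by
    rw [← Finset.sum_coe_sort]
    simp only [hlw]
    exact key x)
  funext e
  rw [← hlw e]
  exact this e.1 e.2

lemma gen {c : V × Fin 2 → ℝ} (hc : AlgebraicIndependent ℚ c) (P : MvPolynomial (V × Fin 2) ℚ)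
    (c' : V × Fin 2 → ℝ) (h : MvPolynomial.aeval c' P ≠ 0) : MvPolynomial.aeval c P ≠ 0 := by
  intro h0
  apply h
  rw [(algebraicIndependent_iff.1 hc) P h0, map_zero]

lemma ind_gen [Fintype V] {c : V × Fin 2 → ℝ} (hc : AlgebraicIndependent ℚ c)
    (c' : V × Fin 2 → ℝ) (F : Finset (Sym2 V)) (h : Ind c' F) : Ind c F := by
  apply ind_of_gram
  have key : ∀ d : V × Fin 2 → ℝ,
      MvPolynomial.aeval d (gram (MvPolynomial.X (R := ℚ)) F).det = (gram d F).det := by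
    intro d
    rw [AlgHom.map_det]
    congr 1
    ext e f
    simp only [gram, AlgHom.mapMatrix_apply, Matrix.map_apply, Matrix.of_apply, map_sum, map_mul]
    refine Finset.sum_congr rfl fun x _ => ?_
    have h1 : ∀ e : Sym2 V,
        MvPolynomial.aeval d (row (MvPolynomial.X (R := ℚ)) e x) = row d e x := by
      intro e
      have := row_map (MvPolynomial.aeval (R := ℚ) d : _ →ₐ[ℚ] ℝ).toRingHom
        (MvPolynomial.X (R := ℚ)) e x
      simpa using this
    rw [h1, h1]
  rw [← key]
  apply gen hc _ c'
  rw [key]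
  exact gram_of_ind _ _ h

/-- noncollinearity -/
lemma noncol {c : V × Fin 2 → ℝ} (hc : AlgebraicIndependent ℚ c) {u a b : V}
    (hua : u ≠ a) (hub : u ≠ b) (hab : a ≠ b) :
    (c (u, 0) - c (a, 0)) * (c (u, 1) - c (b, 1)) - (c (u, 1) - c (a, 1)) * (c (u, 0) - c (b, 0))
      ≠ 0 := by
  have := gen hc
    ((MvPolynomial.X (u, 0) - MvPolynomial.X (a, 0)) * (MvPolynomial.X (u, 1) - MvPolynomial.X (b, 1))
      - (MvPolynomial.X (u, 1) - MvPolynomial.X (a, 1)) *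
        (MvPolynomial.X (u, 0) - MvPolynomial.X (b, 0)))
    (fun x => if x = (a, 0) then 1 else if x = (b, 1) then 1 else 0)
    (by simp [hua, hub, hab, hab.symm])
  simpa using this

lemma ne_gen {c : V × Fin 2 → ℝ} (hc : AlgebraicIndependent ℚ c) {a b : V}
    (hab : a ≠ b) (k : Fin 2) : c (a, k) ≠ c (b, k) := by
  intro h
  have := hc.injective h
  exact hab (congrArg Prod.fst this)

/-! ### Forward direction -/

lemma row_sum [Fintype V] (c : V × Fin 2 → ℝ) (e : Sym2 V) (k : Fin 2) :
    ∑ v, row c e (v, k) = 0 := by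
  induction e using Sym2.ind with
  | _ i j =>
    simp only [row_mk, Finset.sum_add_distrib, Finset.sum_ite_eq', Finset.sum_ite_eq, mem_univ,
      if_true]
    ring

lemma row_moment [Fintype V] (c : V × Fin 2 → ℝ) (e : Sym2 V) :
    ∑ v, (c (v, 0) * row c e (v, 1) - c (v, 1) * row c e (v, 0)) = 0 := by
  induction e using Sym2.ind with
  | _ i j =>
    simp only [row_mk, mul_add, mul_ite, mul_zero, Finset.sum_sub_distrib,
      Finset.sum_add_distrib, Finset.sum_ite_eq', Finset.sum_ite_eq, mem_univ,
      if_true]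
    ring

lemma subset_edgeVerts {F : Finset (Sym2 V)} {e : Sym2 V} (he : e ∈ F) :
    sym2Verts e ⊆ edgeVerts F := Finset.le_sup (f := sym2Verts) he

lemma forward [Fintype V] {c : V × Fin 2 → ℝ} (hc : AlgebraicIndependent ℚ c)
    (F : Finset (Sym2 V)) (hF : ∀ e ∈ F, ¬ e.IsDiag) (hne : F.Nonempty) (h : Ind c F) :
    F.card ≤ 2 * (edgeVerts F).card - 3 := by
  obtain ⟨e0, he0⟩ := hne
  obtain ⟨a, b, rfl⟩ : ∃ a b, e0 = s(a, b) := by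
    induction e0 using Sym2.ind with
    | _ i j => exact ⟨i, j, rfl⟩
  have hab : a ≠ b := by simpa using hF _ he0
  have hsub := subset_edgeVerts he0
  rw [verts_mk] at hsub
  have haW : a ∈ edgeVerts F := hsub (by simp)
  have hbW : b ∈ edgeVerts F := hsub (by simp)
  set T : Finset (V × Fin 2) := {(a, 0), (a, 1), (b, 0)} with hT
  have hTc : T.card = 3 := by
    rw [hT, Finset.card_eq_three]
    exact ⟨_, _, _, by simp, by simp [hab], by simp [hab], rfl⟩
  set S : Finset (V × Fin 2) := (edgeVerts F ×ˢ univ) \ T with hS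
  have hTS : T ⊆ edgeVerts F ×ˢ univ := by
    intro x hx
    simp only [hT, mem_insert, mem_singleton] at hx
    rcases hx with rfl | rfl | rfl <;> simp [haW, hbW]
  have hSc : S.card = 2 * (edgeVerts F).card - 3 := by
    rw [hS, Finset.card_sdiff_of_subset hTS, hTc, Finset.card_product]
    simp [mul_comm]
  have hli : LinearIndepOn ℝ (fun e : Sym2 V => fun x : S => row c e x.1) (F : Set (Sym2 V)) := by
    rw [linearIndepOn_finset_iff]
    intro l hl
    apply h l
    let u : V × Fin 2 → ℝ := fun x => ∑ e ∈ F, l e * row c e x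
    change ∀ x, u x = 0
    have hu1 : ∀ x ∈ S, u x = 0 := by
      intro x hx
      have := congrFun hl ⟨x, hx⟩
      simpa [Finset.sum_apply, u] using this
    have hu2 : ∀ x, x.1 ∉ edgeVerts F → u x = 0 := by
      intro x hx
      refine Finset.sum_eq_zero fun e he => ?_
      rw [row_zero c e x (fun h => hx (subset_edgeVerts he h)), mul_zero]
    have hu3 : ∀ x, x ∉ T → u x = 0 := by
      intro x hx
      by_cases hx1 : x.1 ∈ edgeVerts F
      · exact hu1 x (by simp [hS, hx, hx1])
      · exact hu2 x hx1
    have hsum : ∀ k, ∑ v, u (v, k) = 0 := by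
      intro k
      simp only [u]
      rw [Finset.sum_comm]
      simp [← Finset.mul_sum, row_sum]
    have hmom : ∑ v, (c (v, 0) * u (v, 1) - c (v, 1) * u (v, 0)) = 0 := by
      have : ∀ v, (c (v, 0) * u (v, 1) - c (v, 1) * u (v, 0)) =
          ∑ e ∈ F, l e * (c (v, 0) * row c e (v, 1) - c (v, 1) * row c e (v, 0)) := by
        intro v
        simp only [u, Finset.mul_sum, ← Finset.sum_sub_distrib]
        exact Finset.sum_congr rfl fun _ _ => by ring
      simp only [this]
      rw [Finset.sum_comm]
      refine Finset.sum_eq_zero fun e _ => ?_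
      rw [← Finset.mul_sum, row_moment, mul_zero]
    have hother : ∀ v, v ≠ a → v ≠ b → ∀ k, u (v, k) = 0 := by
      intro v hva hvb k
      exact hu3 _ (by simp [hT, hva, hvb])
    have hb1 : u (b, 1) = 0 := hu3 _ (by simp [hT, hab.symm])
    have h0 := hsum 0
    have h1 := hsum 1
    rw [Fintype.sum_eq_add a b hab (fun v hv => hother v hv.1 hv.2 _)] at h0 h1
    rw [Fintype.sum_eq_add a b hab (fun v hv => by
      rw [hother v hv.1 hv.2, hother v hv.1 hv.2]; simp)] at hmom
    have ha1 : u (a, 1) = 0 := by linarith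
    rw [ha1, hb1] at hmom
    have hb0 : u (b, 0) = - u (a, 0) := by linarith
    rw [hb0] at hmom
    have hne := ne_gen hc hab 1
    have ha0 : u (a, 0) = 0 := by
      have : (c (b, 1) - c (a, 1)) * u (a, 0) = 0 := by linarith
      rcases mul_eq_zero.1 this with h | h
      · exact absurd (by linarith) hne
      · exact h
    rintro ⟨v, k⟩
    by_cases hva : v = a
    · subst hva
      fin_cases k
      · exact ha0
      · exact ha1
    by_cases hvb : v = b
    · subst hvb
      fin_cases k
      · simpa [ha0] using hb0
      · exact hb1
    exact hother v hva hvb k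
  have := LinearIndependent.fintype_card_le_finrank hli
  simp at this
  omega

/-! ### Combinatorics -/

/-- edges induced by `X` -/
def ie (E : Finset (Sym2 V)) (X : Finset V) : Finset (Sym2 V) := E.filter (fun e => sym2Verts e ⊆ X)

/-- vertex version of the Laman condition -/
def Lam (E : Finset (Sym2 V)) : Prop := ∀ X : Finset V, 2 ≤ X.card → (ie E X).card + 3 ≤ 2 * X.card

lemma lam_of_laman {E : Finset (Sym2 V)} (h : Laman E) : Lam E := by
  intro X hX
  rcases (ie E X).eq_empty_or_nonempty with h0 | h0
  · rw [h0]; simp; omega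
  · have h1 := h (ie E X) (Finset.filter_subset _ _) h0
    have h2 : edgeVerts (ie E X) ⊆ X := by
      apply Finset.sup_le
      intro e he
      exact (Finset.mem_filter.1 he).2
    have h3 := Finset.card_le_card h2
    have h4 := h0.card_pos
    omega

lemma Lam.mono {E F : Finset (Sym2 V)} (h : Lam E) (hF : F ⊆ E) : Lam F := by
  intro X hX
  have := Finset.card_le_card (Finset.filter_subset_filter (fun e => sym2Verts e ⊆ X) hF)
  have h2 := h X hX
  unfold ie at *
  omega

lemma supermod (E : Finset (Sym2 V)) (X Y : Finset V) :
    (ie E X).card + (ie E Y).card ≤ (ie E (X ∪ Y)).card + (ie E (X ∩ Y)).card := by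
  rw [← Finset.card_union_add_card_inter]
  have h1 : ie E X ∪ ie E Y ⊆ ie E (X ∪ Y) := by
    intro e he
    simp only [ie, mem_union, mem_filter] at he ⊢
    rcases he with he | he
    · exact ⟨he.1, he.2.trans Finset.subset_union_left⟩
    · exact ⟨he.1, he.2.trans Finset.subset_union_right⟩
  have h2 : ie E X ∩ ie E Y ⊆ ie E (X ∩ Y) := by
    intro e he
    simp only [ie, mem_inter, mem_filter] at he ⊢
    exact ⟨he.1.1, Finset.subset_inter he.1.2 he.2.2⟩
  have := Finset.card_le_card h1
  have := Finset.card_le_card h2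
  omega

lemma union_tight {E : Finset (Sym2 V)} (h : Lam E) {X Y : Finset V}
    (hX : (ie E X).card + 3 = 2 * X.card) (hY : (ie E Y).card + 3 = 2 * Y.card)
    (hc : 2 ≤ (X ∩ Y).card) : 2 * (X ∪ Y).card ≤ (ie E (X ∪ Y)).card + 3 := by
  have h1 := h _ hc
  have h2 := supermod E X Y
  have h3 := Finset.card_union_add_card_inter X Y
  omega

lemma ie_disj {E : Finset (Sym2 V)} (hE : ∀ e ∈ E, ¬ e.IsDiag) {X Y : Finset V}
    (hc : (X ∩ Y).card < 2) : Disjoint (ie E X) (ie E Y) := by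
  rw [Finset.disjoint_left]
  intro e h1 h2
  simp only [ie, mem_filter] at h1 h2
  have := Finset.card_le_card (Finset.subset_inter h1.2 h2.2)
  rw [card_verts e (hE e h1.1)] at this
  omega

lemma three_tight {E : Finset (Sym2 V)} (hE : ∀ e ∈ E, ¬ e.IsDiag) (h : Lam E) {v a b c : V}
    (hab : a ≠ b) (hbc : b ≠ c) (hac : a ≠ c)
    (hW : ∀ W : Finset V, v ∉ W → a ∈ W → b ∈ W → c ∈ W → (ie E W).card + 4 ≤ 2 * W.card)
    {X Y Z : Finset V}
    (hX : (ie E X).card + 3 = 2 * X.card) (hY : (ie E Y).card + 3 = 2 * Y.card)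
    (hZ : (ie E Z).card + 3 = 2 * Z.card) (hvX : v ∉ X) (hvY : v ∉ Y) (hvZ : v ∉ Z)
    (haX : a ∈ X) (hbX : b ∈ X) (hbY : b ∈ Y) (hcY : c ∈ Y) (haZ : a ∈ Z) (hcZ : c ∈ Z) :
    False := by
  by_cases h1 : 2 ≤ (X ∩ Y).card
  · have := union_tight h hX hY h1
    have := hW (X ∪ Y) (by simp [hvX, hvY]) (by simp [haX]) (by simp [hbX]) (by simp [hcY])
    omega
  by_cases h2 : 2 ≤ (X ∩ Z).card
  · have := union_tight h hX hZ h2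
    have := hW (X ∪ Z) (by simp [hvX, hvZ]) (by simp [haX]) (by simp [hbX]) (by simp [hcZ])
    omega
  by_cases h3 : 2 ≤ (Y ∩ Z).card
  · have := union_tight h hY hZ h3
    have := hW (Y ∪ Z) (by simp [hvY, hvZ]) (by simp [haZ]) (by simp [hbY]) (by simp [hcZ])
    omega
  push Not at h1 h2 h3
  have d1 := ie_disj hE h1
  have d2 := ie_disj hE h2
  have d3 := ie_disj hE h3
  have hw := hW (X ∪ Y ∪ Z) (by simp [hvX, hvY, hvZ]) (by simp [haX]) (by simp [hbX])
    (by simp [hcY])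
  have hs : ie E X ∪ ie E Y ∪ ie E Z ⊆ ie E (X ∪ Y ∪ Z) := by
    intro e he
    simp only [ie, mem_union, mem_filter] at he ⊢
    rcases he with (he | he) | he
    · exact ⟨he.1, fun x hx => by simp [he.2 hx]⟩
    · exact ⟨he.1, fun x hx => by simp [he.2 hx]⟩
    · exact ⟨he.1, fun x hx => by simp [he.2 hx]⟩
  have hs' := Finset.card_le_card hs
  rw [Finset.card_union_of_disjoint (by rw [Finset.disjoint_union_left]; exact ⟨d2, d3⟩),
    Finset.card_union_of_disjoint d1] at hs'
  have c1 := Finset.card_union_add_card_inter X Y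
  have c2 := Finset.card_union_add_card_inter (X ∪ Y) Z
  have c3 : 1 ≤ (X ∩ Y).card := Finset.card_pos.2 ⟨b, by simp [hbX, hbY]⟩
  have c4 : 2 ≤ ((X ∪ Y) ∩ Z).card := by
    rw [← Finset.card_pair hac]
    apply Finset.card_le_card
    intro x hx
    simp only [mem_insert, mem_singleton] at hx
    rcases hx with rfl | rfl <;> simp [haX, haZ, hcY, hcZ]
  omega

lemma tight_or {E : Finset (Sym2 V)} (h : Lam E) {v a b : V}
    (hv : ∀ e ∈ E, v ∉ sym2Verts e) (hab : a ≠ b) (hva : v ≠ a) (hvb : v ≠ b) :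
    (s(a, b) ∉ E ∧ Lam (insert s(a, b) E)) ∨
      ∃ X : Finset V, (ie E X).card + 3 = 2 * X.card ∧ v ∉ X ∧ a ∈ X ∧ b ∈ X := by
  by_cases hmem : s(a, b) ∈ E
  · right
    refine ⟨{a, b}, ?_, by simp [hva, hvb], by simp, by simp⟩
    have h1 := h {a, b} (by rw [Finset.card_pair hab])
    have h2 : 0 < (ie E {a, b}).card := Finset.card_pos.2 ⟨s(a, b), by simp [ie, hmem, verts_mk]⟩
    rw [Finset.card_pair hab] at *
    omega
  by_cases hL : Lam (insert s(a, b) E)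
  · exact Or.inl ⟨hmem, hL⟩
  right
  unfold Lam at hL
  push Not at hL
  obtain ⟨X, hX2, hX⟩ := hL
  have h1 := h X hX2
  by_cases hs : sym2Verts s(a, b) ⊆ X
  · have hle : (ie (insert s(a, b) E) X).card ≤ (ie E X).card + 1 := by
      unfold ie
      rw [Finset.filter_insert, if_pos hs]
      exact Finset.card_insert_le _ _
    rw [verts_mk] at hs
    have haX : a ∈ X := hs (by simp)
    have hbX : b ∈ X := hs (by simp)
    refine ⟨X, by omega, ?_, haX, hbX⟩
    intro hvX
    have h2 := h (X.erase v) (by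
      rw [← Finset.card_pair hab]
      apply Finset.card_le_card
      intro x hx
      simp only [mem_insert, mem_singleton] at hx
      rcases hx with rfl | rfl
      · simp [haX, hva.symm]
      · simp [hbX, hvb.symm])
    have h3 : ie E X ⊆ ie E (X.erase v) := by
      intro e he
      simp only [ie, mem_filter] at he ⊢
      exact ⟨he.1, Finset.subset_erase.2 ⟨he.2, hv e he.1⟩⟩
    have h4 := Finset.card_le_card h3
    rw [Finset.card_erase_of_mem hvX] at h2
    omega
  · exfalso
    have : ie (insert s(a, b) E) X = ie E X := by
      unfold ie
      rw [Finset.filter_insert, if_neg hs]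
    rw [this] at hX
    omega

lemma exists_low {E : Finset (Sym2 V)} (hE : ∀ e ∈ E, ¬ e.IsDiag) (h : Lam E)
    (hne : E.Nonempty) : ∃ v, 1 ≤ (E.filter (fun e => v ∈ sym2Verts e)).card ∧
      (E.filter (fun e => v ∈ sym2Verts e)).card ≤ 3 := by
  by_contra! hcon
  have hdeg : ∀ v ∈ edgeVerts E, 4 ≤ (E.filter (fun e => v ∈ sym2Verts e)).card := by
    intro v hv
    apply hcon v
    apply Finset.card_pos.2
    unfold edgeVerts at hv
    rw [Finset.mem_sup] at hv
    obtain ⟨e, he, hve⟩ := hv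
    exact ⟨e, by simp [he, hve]⟩
  have h1 : 4 * (edgeVerts E).card ≤
      ∑ v ∈ edgeVerts E, (E.filter (fun e => v ∈ sym2Verts e)).card := by
    have := Finset.card_nsmul_le_sum _ _ _ hdeg
    simpa [mul_comm] using this
  have h2 : ∑ v ∈ edgeVerts E, (E.filter (fun e => v ∈ sym2Verts e)).card = 2 * E.card := by
    have := Finset.sum_card_bipartiteAbove_eq_sum_card_bipartiteBelow
      (s := edgeVerts E) (t := E) (fun v e => v ∈ sym2Verts e)
    unfold Finset.bipartiteAbove Finset.bipartiteBelow at this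
    rw [this, Finset.sum_congr rfl (g := fun _ => 2)]
    · simp [mul_comm]
    · intro e he
      rw [← card_verts e (hE e he)]
      congr 1
      ext v
      simp only [mem_filter, and_iff_right_iff_imp]
      exact fun hv => subset_edgeVerts he hv
  obtain ⟨e, he⟩ := hne
  have h3 := h (edgeVerts E) (by
    rw [← card_verts e (hE e he)]; exact Finset.card_le_card (subset_edgeVerts he))
  have h4 : ie E (edgeVerts E) = E := Finset.filter_true_of_mem fun e he => subset_edgeVerts he
  rw [h4] at h3
  omega

/-! ### Extensions -/

lemma sum_at_v {c : V × Fin 2 → ℝ} {E : Finset (Sym2 V)} {v : V}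
    (hv : ∀ e ∈ E, v ∉ sym2Verts e) (l : Sym2 V → ℝ) (k : Fin 2) :
    ∑ e ∈ E, l e * row c e (v, k) = 0 :=
  Finset.sum_eq_zero fun e he => by rw [row_zero c e _ (hv e he), mul_zero]

lemma row_at {c : V × Fin 2 → ℝ} {v a : V} (h : v ≠ a) (k : Fin 2) :
    row c s(v, a) (v, k) = c (v, k) - c (a, k) := by
  simp [row_mk, h]

lemma not_mem_of {E : Finset (Sym2 V)} {v : V} (hv : ∀ e ∈ E, v ∉ sym2Verts e) (a : V) :
    s(v, a) ∉ E := fun h => hv _ h (by simp [verts_mk])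

lemma ext_one {c : V × Fin 2 → ℝ} (hc : AlgebraicIndependent ℚ c) {E : Finset (Sym2 V)} {v a : V}
    (hv : ∀ e ∈ E, v ∉ sym2Verts e) (hva : v ≠ a) (h : Ind c E) : Ind c (insert s(v, a) E) := by
  intro l hl
  simp only [Finset.sum_insert (not_mem_of hv a)] at hl
  have h0 := hl (v, 0)
  rw [sum_at_v hv, row_at hva, add_zero] at h0
  have hla : l s(v, a) = 0 := by
    rcases mul_eq_zero.1 h0 with h | h
    · exact h
    · exact absurd (by linarith) (ne_gen hc hva 0)
  simp only [hla, zero_mul, zero_add] at hl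
  have := h l hl
  intro e he
  rcases Finset.mem_insert.1 he with rfl | he
  · exact hla
  · exact this e he

lemma ext_two {c : V × Fin 2 → ℝ} (hc : AlgebraicIndependent ℚ c) {E : Finset (Sym2 V)} {v a b : V}
    (hv : ∀ e ∈ E, v ∉ sym2Verts e) (hva : v ≠ a) (hvb : v ≠ b) (hab : a ≠ b) (h : Ind c E) :
    Ind c (insert s(v, a) (insert s(v, b) E)) := by
  intro l hl
  have hn : s(v, a) ∉ insert s(v, b) E := by
    simp [not_mem_of hv a, hab, hvb]
  simp only [Finset.sum_insert hn, Finset.sum_insert (not_mem_of hv b)] at hl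
  have h0 := hl (v, 0)
  have h1 := hl (v, 1)
  rw [sum_at_v hv, row_at hva, row_at hvb, add_zero] at h0 h1
  have hnc := noncol hc hva hvb hab
  have hla : l s(v, a) = 0 := by
    refine (mul_eq_zero.1 (?_ : l s(v, a) * _ = 0)).resolve_right hnc
    linear_combination (c (v, 1) - c (b, 1)) * h0 - (c (v, 0) - c (b, 0)) * h1
  have hlb : l s(v, b) = 0 := by
    refine (mul_eq_zero.1 (?_ : l s(v, b) * _ = 0)).resolve_right hnc
    linear_combination (c (v, 0) - c (a, 0)) * h1 - (c (v, 1) - c (a, 1)) * h0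
  simp only [hla, hlb, zero_mul, zero_add] at hl
  have := h l hl
  intro e he
  rcases Finset.mem_insert.1 he with rfl | he
  · exact hla
  rcases Finset.mem_insert.1 he with rfl | he
  · exact hlb
  · exact this e he

lemma ext_three [Fintype V] {c : V × Fin 2 → ℝ} (hc : AlgebraicIndependent ℚ c)
    {E : Finset (Sym2 V)} {v a b d : V}
    (hv : ∀ e ∈ E, v ∉ sym2Verts e) (hva : v ≠ a) (hvb : v ≠ b) (hvd : v ≠ d)
    (hab : a ≠ b) (had : a ≠ d) (hbd : b ≠ d) (hm : s(a, b) ∉ E)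
    (h : Ind c (insert s(a, b) E)) :
    Ind c (insert s(v, a) (insert s(v, b) (insert s(v, d) E))) := by
  let c' : V × Fin 2 → ℝ := fun x =>
    if x.1 = v then (c (a, x.2) + c (b, x.2)) / 2 else c x
  have c'v : ∀ k, c' (v, k) = (c (a, k) + c (b, k)) / 2 := fun k => by simp [c']
  have c'o : ∀ w, w ≠ v → ∀ k, c' (w, k) = c (w, k) := fun w hw k => by simp [c', hw]
  apply ind_gen hc c'
  intro l hl
  have hn1 : s(v, b) ∉ insert s(v, d) E := by
    simp [not_mem_of hv b, hbd, hvd]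
  have hn2 : s(v, a) ∉ insert s(v, b) (insert s(v, d) E) := by
    simp [not_mem_of hv a, hab, hvb, had, hvd]
  simp only [Finset.sum_insert hn2, Finset.sum_insert hn1, Finset.sum_insert (not_mem_of hv d)]
    at hl
  have h0 := hl (v, 0)
  have h1 := hl (v, 1)
  rw [sum_at_v hv, row_at hva, row_at hvb, row_at hvd, add_zero, c'v, c'o a hva.symm,
    c'o b hvb.symm, c'o d hvd.symm] at h0 h1
  have hnc := noncol hc had.symm hbd.symm hab
  have hld : l s(v, d) = 0 := by
    refine (mul_eq_zero.1 (?_ : l s(v, d) * _ = 0)).resolve_right hnc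
    linear_combination (c (b, 1) - c (a, 1)) * h0 - (c (b, 0) - c (a, 0)) * h1
  have hlab : l s(v, a) = l s(v, b) := by
    have hne := ne_gen hc hab 0
    have : (l s(v, a) - l s(v, b)) * (c (a, 0) - c (b, 0)) = 0 := by
      rw [hld] at h0
      linear_combination (-2) * h0
    rcases mul_eq_zero.1 this with h | h
    · linarith
    · exact absurd (by linarith) hne
  let l' : Sym2 V → ℝ := fun e => if e = s(a, b) then l s(v, a) / 2 else l e
  have hl'0 : l' s(a, b) = l s(v, a) / 2 := by simp [l']
  have hl'E : ∀ e ∈ E, l' e = l e := by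
    intro e he
    have : e ≠ s(a, b) := fun h => hm (h ▸ he)
    simp [l', this]
  have hfin := h l' (by
    rintro ⟨w, k⟩
    rw [Finset.sum_insert hm, hl'0]
    have := hl (w, k)
    rw [hld, zero_mul, zero_add, ← hlab] at this
    rw [← this, ← add_assoc]
    congr 1
    · simp only [row_mk, c'v, c'o a hva.symm, c'o b hvb.symm]
      by_cases hwv : w = v
      · subst hwv
        simp only [hva, hvb, if_true, if_false]
        ring
      · simp only [hwv, if_false]
        split_ifs <;> ring
    · refine Finset.sum_congr rfl fun e he => ?_
      rw [hl'E e he, row_congr c c' e (w, k)]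
      intro u hu k
      exact (c'o u (fun h => hv e he (h ▸ hu)) k).symm)
  have hla : l s(v, a) = 0 := by
    have := hfin s(a, b) (by simp)
    rw [hl'0] at this
    linarith
  intro e he
  simp only [mem_insert] at he
  rcases he with rfl | rfl | rfl | he
  · exact hla
  · rw [← hlab]; exact hla
  · exact hld
  · rw [← hl'E e he]; exact hfin e (by simp [he])

lemma exists_other {e : Sym2 V} {v : V} (hv : v ∈ sym2Verts e) (he : ¬ e.IsDiag) :
    ∃ a, v ≠ a ∧ e = s(v, a) := by
  rw [mem_verts] at hv
  obtain ⟨a, rfl⟩ := hv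
  exact ⟨a, by simpa using he, rfl⟩

lemma backward [Fintype V] {c : V × Fin 2 → ℝ} (hc : AlgebraicIndependent ℚ c) :
    ∀ (n : ℕ) (E : Finset (Sym2 V)), E.card = n → (∀ e ∈ E, ¬ e.IsDiag) → Lam E → Ind c E := by
  intro n
  induction n using Nat.strong_induction_on with
  | _ n ih =>
  intro E hn hE h
  rcases E.eq_empty_or_nonempty with rfl | hne
  · intro l _ e he; simp at he
  obtain ⟨v, hv1, hv3⟩ := exists_low hE h hne
  set D := E.filter (fun e => v ∈ sym2Verts e) with hD
  set E0 := E.filter (fun e => v ∉ sym2Verts e) with hE0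
  have hunion : D ∪ E0 = E := Finset.filter_union_filter_not_eq _ _
  have hcard : D.card + E0.card = E.card := Finset.card_filter_add_card_filter_not _
  have hE0s : E0 ⊆ E := Finset.filter_subset _ _
  have hv : ∀ e ∈ E0, v ∉ sym2Verts e := fun e he => (Finset.mem_filter.1 he).2
  have hE0d : ∀ e ∈ E0, ¬ e.IsDiag := fun e he => hE e (hE0s he)
  have hL0 := h.mono hE0s
  have hDo : ∀ e ∈ D, ∃ a, v ≠ a ∧ e = s(v, a) := fun e he =>
    exists_other (Finset.mem_filter.1 he).2 (hE e (Finset.mem_filter.1 he).1)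
  have hI0 : Ind c E0 := ih E0.card (by omega) E0 rfl hE0d hL0
  have h123 : D.card = 1 ∨ D.card = 2 ∨ D.card = 3 := by omega
  rcases h123 with hd | hd | hd
  · obtain ⟨e, hDe⟩ := Finset.card_eq_one.1 hd
    obtain ⟨a, hva, rfl⟩ := hDo e (by rw [hDe]; simp)
    rw [← hunion, hDe]
    exact ext_one hc hv hva hI0
  · obtain ⟨e, f, hef, hDe⟩ := Finset.card_eq_two.1 hd
    obtain ⟨a, hva, rfl⟩ := hDo e (by rw [hDe]; simp)
    obtain ⟨b, hvb, rfl⟩ := hDo f (by rw [hDe]; simp)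
    have hab : a ≠ b := fun h => hef (by rw [h])
    have := ext_two hc hv hva hvb hab hI0
    rw [← hunion, hDe]
    refine this.mono ?_
    intro x hx
    simp only [mem_union, mem_insert, mem_singleton] at hx ⊢
    tauto
  · obtain ⟨e, f, g, hef, heg, hfg, hDe⟩ := Finset.card_eq_three.1 hd
    obtain ⟨a, hva, rfl⟩ := hDo e (by rw [hDe]; simp)
    obtain ⟨b, hvb, rfl⟩ := hDo f (by rw [hDe]; simp)
    obtain ⟨d, hvd, rfl⟩ := hDo g (by rw [hDe]; simp)
    have hab : a ≠ b := fun h => hef (by rw [h])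
    have had : a ≠ d := fun h => heg (by rw [h])
    have hbd : b ≠ d := fun h => hfg (by rw [h])
    have hsub : ∀ x ∈ D, x ∈ E := fun x hx => (Finset.mem_filter.1 hx).1
    have ins : ∀ x y : V, x ≠ y → s(x, y) ∉ E0 ∧ Lam (insert s(x, y) E0) →
        Ind c (insert s(x, y) E0) := by
      intro x y hxy hh
      refine ih (insert s(x, y) E0).card ?_ _ rfl ?_ hh.2
      · rw [Finset.card_insert_of_notMem hh.1]; omega
      · intro e he
        rcases Finset.mem_insert.1 he with rfl | he
        · simpa using hxy
        · exact hE0d e he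
    rcases tight_or hL0 hv hab hva hvb with h1 | ⟨X, hX, hvX, haX, hbX⟩
    · have := ext_three hc hv hva hvb hvd hab had hbd h1.1 (ins _ _ hab h1)
      refine this.mono ?_
      rw [← hunion, hDe]
      intro x hx
      simp only [mem_union, mem_insert, mem_singleton] at hx ⊢
      tauto
    rcases tight_or hL0 hv hbd hvb hvd with h1 | ⟨Y, hY, hvY, hbY, hdY⟩
    · have := ext_three hc hv hvb hvd hva hbd hab.symm had.symm h1.1 (ins _ _ hbd h1)
      refine this.mono ?_
      rw [← hunion, hDe]
      intro x hx
      simp only [mem_union, mem_insert, mem_singleton] at hx ⊢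
      tauto
    rcases tight_or hL0 hv had hva hvd with h1 | ⟨Z, hZ, hvZ, haZ, hdZ⟩
    · have := ext_three hc hv hva hvd hvb had hab hbd.symm h1.1 (ins _ _ had h1)
      refine this.mono ?_
      rw [← hunion, hDe]
      intro x hx
      simp only [mem_union, mem_insert, mem_singleton] at hx ⊢
      tauto
    exfalso
    refine three_tight hE0d hL0 hab hbd had ?_ hX hY hZ hvX hvY hvZ haX hbX hbY hdY haZ hdZ
    intro W hvW haW hbW hdW
    have hW := h (insert v W) (by
      rw [Finset.card_insert_of_notMem hvW]
      have := Finset.card_pos.2 ⟨a, haW⟩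
      omega)
    rw [Finset.card_insert_of_notMem hvW] at hW
    have hs : D ∪ ie E0 W ⊆ ie E (insert v W) := by
      intro x hx
      rcases Finset.mem_union.1 hx with hx | hx
      · refine Finset.mem_filter.2 ⟨hsub x hx, ?_⟩
        rw [hDe] at hx
        simp only [mem_insert, mem_singleton] at hx
        intro y hy
        rcases hx with rfl | rfl | rfl <;>
        · simp only [verts_mk, mem_insert, mem_singleton] at hy
          rcases hy with rfl | rfl <;> simp [haW, hbW, hdW]
      · have := Finset.mem_filter.1 hx
        exact Finset.mem_filter.2 ⟨hE0s this.1, this.2.trans (Finset.subset_insert _ _)⟩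
    have hdisj : Disjoint D (ie E0 W) := by
      rw [Finset.disjoint_left]
      intro x hx hx'
      exact hv x (Finset.mem_filter.1 hx').1 (Finset.mem_filter.1 hx).2
    have := Finset.card_le_card hs
    rw [Finset.card_union_of_disjoint hdisj] at this
    omega

end

end LamanAux

/-- **Laman's Theorem.**  For a generic configuration `p` of a finite vertex set `V`
in the plane (all `2|V|` coordinates algebraically independent over `ℚ`), the
rigidity-matrix rows of an edge set `E` are linearly independent in `(ℝ²)^V`
if and only if `E` satisfies Laman's condition. -/
theorem laman_theorem {V : Type*} [Fintype V] [DecidableEq V] (p : V → ℝ × ℝ)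
    (hgen : AlgebraicIndependent ℚ (coords p))
    (E : Finset (Sym2 V)) (hE : ∀ e ∈ E, ¬ e.IsDiag) :
    LinearIndependent ℝ (fun e : E => rigRow p e.1) ↔ Laman E := by
  rw [LamanAux.ind_iff]
  constructor
  · intro h F hF hne
    exact LamanAux.forward hgen F (fun e he => hE e (hF he)) hne (h.mono hF)
  · intro h
    exact LamanAux.backward hgen _ E rfl hE (LamanAux.lam_of_laman h)
end

section
/- A pinned graph G(I,P;E) admits a realization p : I ∪ P → ℝ² that is pinned isostatic (the rows of the pinned rigidity matrix indexed by E are linearly independent and their rank is 2|I|) if and only if G satisfies the Pinned Framework Conditions. -/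
/-- A pinned graph `G(I,P;E)`: disjoint finite sets `I` of inner vertices and `P` of
pinned vertices, and a set `E` of edges (with two distinct endpoints), each having all
endpoints in `I ∪ P` and at least one endpoint in `I`. -/
structure IsPinnedGraph {V : Type*} [DecidableEq V]
    (I P : Finset V) (E : Finset (Sym2 V)) : Prop where
  disj : Disjoint I P
  not_diag : ∀ e ∈ E, ¬ e.IsDiag
  endpoints : ∀ e ∈ E, sym2Verts e ⊆ I ∪ P
  inner : ∀ e ∈ E, (sym2Verts e ∩ I).Nonempty

/-- The Pinned Framework Conditions for a pinned graph `G(I,P;E)`: `|E| = 2|I|`, and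
every nonempty `E' ⊆ E`, with inner endpoint set `I'` and pinned endpoint set `P'`,
satisfies `|E'| ≤ 2|I'|` if `|P'| ≥ 2`, `|E'| ≤ 2|I'| - 1` if `|P'| = 1`, and
`|E'| ≤ 2|I'| - 3` if `P' = ∅`. -/
def PinnedConditions {V : Type*} [DecidableEq V]
    (I P : Finset V) (E : Finset (Sym2 V)) : Prop :=
  E.card = 2 * I.card ∧
  ∀ E' ⊆ E, E'.Nonempty →
    (2 ≤ (edgeVerts E' ∩ P).card → E'.card ≤ 2 * (edgeVerts E' ∩ I).card) ∧
    ((edgeVerts E' ∩ P).card = 1 → E'.card ≤ 2 * (edgeVerts E' ∩ I).card - 1) ∧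
    (edgeVerts E' ∩ P = ∅ → E'.card ≤ 2 * (edgeVerts E' ∩ I).card - 3)

/-- The row of the pinned rigidity matrix corresponding to an edge `{i,j}`: the entry at
an inner vertex `i` is `p i - p j`, the entry at an inner vertex `j` is `p j - p i`, and
all other entries are `0` (pinned vertices contribute no columns). -/
def pinnedRow {V : Type*} [DecidableEq V] (p : V → ℝ × ℝ) (I : Finset V)
    (e : Sym2 V) : V → ℝ × ℝ :=
  Sym2.lift ⟨fun i j v => if v ∈ I then
      (if v = i then p i - p j else 0) + (if v = j then p j - p i else 0) else 0,
    fun i j => funext fun v => by by_cases h : v ∈ I <;> simp [h, add_comm]⟩ e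

/-- A realization `p` of a pinned graph is pinned isostatic if the rows of the pinned
rigidity matrix indexed by `E` are linearly independent and their span has rank `2|I|`. -/
def PinnedIsostatic {V : Type*} [DecidableEq V] (I : Finset V) (E : Finset (Sym2 V))
    (p : V → ℝ × ℝ) : Prop :=
  LinearIndependent ℝ (fun e : E => pinnedRow p I e.1) ∧
  Module.finrank ℝ (Submodule.span ℝ (Set.range (fun e : E => pinnedRow p I e.1)))
    = 2 * I.card


namespace PinnedAux

open Finset

variable {V : Type*} [DecidableEq V]

lemma mem_sv {v : V} {e : Sym2 V} : v ∈ sym2Verts e ↔ v ∈ e := by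
  induction e with
  | _ a b => simp [sym2Verts]

lemma sv_mk (a b : V) : sym2Verts s(a, b) = {a, b} := rfl

/-- edges induced by a vertex set -/
def iE (E : Finset (Sym2 V)) (X : Finset V) : Finset (Sym2 V) :=
  E.filter (fun e => sym2Verts e ⊆ X)

/-- the sparsity bound (plus 3) -/
def gg (I X : Finset V) : ℕ := 2 * (X ∩ I).card + min (2 * (X \ I).card) 3

/-- sparsity in vertex-set form -/
def Sparse (I : Finset V) (E : Finset (Sym2 V)) : Prop :=
  ∀ X : Finset V, 2 ≤ X.card → (iE E X).card + 3 ≤ gg I X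

/-- loopless edges meeting the inner set -/
def Good (I : Finset V) (E : Finset (Sym2 V)) : Prop :=
  ∀ e ∈ E, ¬ e.IsDiag ∧ ∃ v ∈ e, v ∈ I

lemma card_split (I X : Finset V) : (X ∩ I).card + (X \ I).card = X.card :=
  card_inter_add_card_sdiff X I

lemma gg_ge {I X : Finset V} (h : 2 ≤ X.card) : 3 ≤ gg I X := by
  have := card_split I X
  unfold gg; omega

lemma gg_mono {I X Y : Finset V} (h : X ⊆ Y) : gg I X ≤ gg I Y := by
  have h1 := card_le_card (inter_subset_inter h (Subset.refl I))
  have h2 := card_le_card (sdiff_subset_sdiff h (Subset.refl I))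
  unfold gg; omega

lemma gg_sub (I X Y : Finset V) : gg I (X ∪ Y) + gg I (X ∩ Y) ≤ gg I X + gg I Y := by
  have h1 := card_union_add_card_inter (X ∩ I) (Y ∩ I)
  have h2 := card_union_add_card_inter (X \ I) (Y \ I)
  rw [← union_inter_distrib_right, ← inter_inter_distrib_right] at h1
  have e1 : (X \ I) ∪ (Y \ I) = (X ∪ Y) \ I := by ext; simp; tauto
  have e2 : (X \ I) ∩ (Y \ I) = (X ∩ Y) \ I := by ext; simp; tauto
  rw [e1, e2] at h2
  have h3 : ((X ∩ Y) \ I).card ≤ (X \ I).card := card_le_card (sdiff_subset_sdiff inter_subset_left (Subset.refl I))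
  have h4 : ((X ∩ Y) \ I).card ≤ (Y \ I).card := card_le_card (sdiff_subset_sdiff inter_subset_right (Subset.refl I))
  unfold gg; omega

lemma gg_single (I : Finset V) (a : V) : gg I {a} = 2 := by
  unfold gg
  by_cases h : a ∈ I
  · have : ({a} : Finset V) \ I = ∅ := by ext; simp; rintro rfl; exact h
    have h2 : ({a} : Finset V) ∩ I = {a} := by ext; simp; rintro rfl; exact h
    simp [this, h2]
  · have : ({a} : Finset V) \ I = {a} := by ext; simp; rintro rfl; exact h
    have h2 : ({a} : Finset V) ∩ I = ∅ := by ext; simp; rintro rfl; exact h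
    simp [this, h2]

lemma gg_pair {I : Finset V} {a b : V} (hab : a ≠ b) (h : a ∈ I ∨ b ∈ I) : gg I {a, b} = 4 := by
  have h1 := card_split I {a, b}
  rw [card_pair hab] at h1
  have h2 : 0 < (({a, b} : Finset V) ∩ I).card := by
    rw [card_pos]
    rcases h with h | h
    · exact ⟨a, by simp [h]⟩
    · exact ⟨b, by simp [h]⟩
  unfold gg; omega

lemma gg_pins {I X : Finset V} (h : X ∩ I = ∅) (h2 : 2 ≤ X.card) : gg I X = 3 := by
  have := card_split I X
  unfold gg; rw [h] at *; simp at *; omega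

lemma gg_insert_inner {I X : Finset V} {v : V} (hv : v ∈ I) (hx : v ∉ X) :
    gg I (insert v X) = gg I X + 2 := by
  unfold gg
  rw [insert_inter_of_mem hv, insert_sdiff_of_mem _ hv, card_insert_of_notMem (by simp [hx])]
  omega

lemma gg_erase {I X : Finset V} {v : V} (hx : v ∉ X) : gg (I.erase v) X = gg I X := by
  unfold gg
  have h1 : X ∩ I.erase v = X ∩ I := by ext x; simp; rintro h _ rfl; exact hx h
  have h2 : X \ I.erase v = X \ I := by
    ext x; simp
    intro h
    have : x ≠ v := by rintro rfl; exact hx h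
    tauto
  rw [h1, h2]

lemma iE_super (E : Finset (Sym2 V)) (X Y : Finset V) :
    (iE E X).card + (iE E Y).card ≤ (iE E (X ∪ Y)).card + (iE E (X ∩ Y)).card := by
  rw [← card_union_add_card_inter]
  apply Nat.add_le_add
  · apply card_le_card
    intro e; simp only [iE, mem_union, mem_filter]
    rintro (h | h)
    · exact ⟨h.1, h.2.trans subset_union_left⟩
    · exact ⟨h.1, h.2.trans subset_union_right⟩
  · apply card_le_card
    intro e; simp only [iE, mem_inter, mem_filter]
    rintro ⟨h, h'⟩
    exact ⟨h.1, subset_inter h.2 h'.2⟩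

lemma iE_single {I : Finset V} {E : Finset (Sym2 V)} (hg : Good I E) (a : V) : iE E {a} = ∅ := by
  ext e
  simp only [iE, mem_filter, notMem_empty, iff_false]
  rintro ⟨he, hs⟩
  have := (hg e he).1
  induction e with
  | _ x y =>
    simp only [sv_mk, insert_subset_iff, singleton_subset_iff, mem_singleton] at hs
    simp at this
    exact this (hs.1.trans hs.2.symm)

lemma iE_pins {I X : Finset V} {E : Finset (Sym2 V)} (hg : Good I E) (h : X ∩ I = ∅) : iE E X = ∅ := by
  ext e
  simp only [iE, mem_filter, notMem_empty, iff_false]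
  rintro ⟨he, hs⟩
  obtain ⟨v, hv, hvI⟩ := (hg e he).2
  have : v ∈ X ∩ I := mem_inter.2 ⟨hs (mem_sv.2 hv), hvI⟩
  simp [h] at this

/-- tight sets -/
def Tight (I : Finset V) (E : Finset (Sym2 V)) (X : Finset V) : Prop :=
  gg I X ≤ (iE E X).card + 3

lemma Tight.union {I X Y : Finset V} {E : Finset (Sym2 V)} (hs : Sparse I E)
    (hX : Tight I E X) (hY : Tight I E Y) (h : 2 ≤ (X ∩ Y).card) : Tight I E (X ∪ Y) := by
  have h1 := iE_super E X Y
  have h2 := gg_sub I X Y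
  have h3 := hs _ h
  unfold Tight at *; omega

/-- removal of v -/
def del (E : Finset (Sym2 V)) (v : V) : Finset (Sym2 V) := E.filter (fun e => v ∉ sym2Verts e)

lemma iE_del {E : Finset (Sym2 V)} {v : V} {X : Finset V} : iE (del E v) X = iE E (X.erase v) := by
  ext e
  simp only [iE, del, mem_filter, subset_erase]
  tauto

lemma Sparse.del {I : Finset V} {E : Finset (Sym2 V)} (hg : Good I E) (hs : Sparse I E) (v : V) :
    Sparse (I.erase v) (del E v) := by
  intro X hX
  rw [iE_del]
  by_cases h : 2 ≤ (X.erase v).card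
  · have := hs _ h
    rw [← gg_erase (notMem_erase v X)] at this
    exact this.trans (gg_mono (erase_subset _ _))
  · have : (iE E (X.erase v)).card = 0 := by
      rw [card_eq_zero]
      have h1 : (X.erase v).card ≤ 1 := by omega
      have h2 := pred_card_le_card_erase (s := X) (a := v)
      obtain ⟨a, ha⟩ := card_eq_one.1 (show (X.erase v).card = 1 by omega)
      rw [ha]; exact iE_single hg a
    rw [this]
    simpa using gg_ge hX

lemma Good.del {I : Finset V} {E : Finset (Sym2 V)} (hg : Good I E) (v : V) :
    Good (I.erase v) (del E v) := by
  intro e he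
  simp only [PinnedAux.del, mem_filter, mem_sv] at he
  obtain ⟨h1, u, h2, h3⟩ := hg e he.1
  exact ⟨h1, u, h2, mem_erase.2 ⟨by rintro rfl; exact he.2 h2, h3⟩⟩

lemma add_or_tight {I : Finset V} {E : Finset (Sym2 V)} (hg : Good I E) (hs : Sparse I E)
    {v a b : V} (hab : a ≠ b) (ha : a ≠ v) (hb : b ≠ v) :
    (s(a, b) ∉ del E v ∧ Good (I.erase v) (insert s(a, b) (del E v)) ∧
      Sparse (I.erase v) (insert s(a, b) (del E v))) ∨
    ∃ X, v ∉ X ∧ a ∈ X ∧ b ∈ X ∧ Tight I E X := by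
  by_cases hE : s(a, b) ∈ E
  · right
    refine ⟨{a, b}, by simp [ha.symm, hb.symm], by simp, by simp, ?_⟩
    have h1 : a ∈ I ∨ b ∈ I := by
      obtain ⟨_, u, hu, huI⟩ := hg _ hE
      rcases Sym2.mem_iff.1 hu with rfl | rfl <;> simp [huI]
    have h2 : 0 < (iE E {a, b}).card := card_pos.2 ⟨s(a, b), by simp [iE, hE, sv_mk]⟩
    unfold Tight; rw [gg_pair hab h1]; omega
  by_cases hI : a ∈ I ∨ b ∈ I
  swap
  · right
    refine ⟨{a, b}, by simp [ha.symm, hb.symm], by simp, by simp, ?_⟩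
    push Not at hI
    unfold Tight
    rw [gg_pins _ (card_pair hab).ge]
    · omega
    · ext x; simp; rintro (rfl | rfl); exacts [hI.1, hI.2]
  by_cases hS : Sparse (I.erase v) (insert s(a, b) (del E v))
  · left
    refine ⟨fun h => hE (mem_filter.1 h).1, ?_, hS⟩
    intro e he
    rcases mem_insert.1 he with rfl | he
    · refine ⟨by simpa using hab, ?_⟩
      rcases hI with h | h
      · exact ⟨a, by simp, by simp [ha, h]⟩
      · exact ⟨b, by simp, by simp [hb, h]⟩
    · exact hg.del v e he
  · right
    unfold Sparse at hS
    push Not at hS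
    obtain ⟨X, hX, hlt⟩ := hS
    have h0 := (hs.del hg v) X hX
    by_cases hx : a ∈ X ∧ b ∈ X
    · refine ⟨X.erase v, by simp, by simp [ha, hx], by simp [hb, hx], ?_⟩
      have h1 : (iE (insert s(a, b) (del E v)) X).card ≤ (iE (del E v) X).card + 1 := by
        refine le_trans (card_le_card ?_) (card_insert_le s(a, b) _)
        intro e; simp only [iE, mem_filter, mem_insert]; tauto
      rw [iE_del] at h1
      have h2 : gg (I.erase v) (X.erase v) ≤ gg (I.erase v) X := gg_mono (erase_subset _ _)
      rw [gg_erase (notMem_erase v X)] at h2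
      unfold Tight; omega
    · exfalso
      have : iE (insert s(a, b) (del E v)) X = iE (del E v) X := by
        ext e; simp only [iE, mem_filter, mem_insert]
        constructor
        · rintro ⟨rfl | h, h'⟩
          · exact absurd (by simpa [sv_mk, insert_subset_iff] using h') hx
          · exact ⟨h, h'⟩
        · tauto
      rw [this] at hlt; omega

lemma no_tight3 {I : Finset V} {E : Finset (Sym2 V)} (hs : Sparse I E)
    {v a b c : V} (hv : v ∈ I) (hab : a ≠ b) (hac : a ≠ c) (hbc : b ≠ c)
    (hva : s(v, a) ∈ E) (hvb : s(v, b) ∈ E) (hvc : s(v, c) ∈ E)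
    {X : Finset V} (hX : v ∉ X) (haX : a ∈ X) (hbX : b ∈ X) (hcX : c ∈ X) : ¬ Tight I E X := by
  intro ht
  have h2 : 2 ≤ (insert v X).card := by
    have : ({a, b} : Finset V) ⊆ insert v X := by
      intro x; simp; rintro (rfl | rfl) <;> simp [*]
    exact (card_pair hab).ge.trans (card_le_card this)
  have h := hs _ h2
  rw [gg_insert_inner hv hX] at h
  have h3 : (iE E X).card + 3 ≤ (iE E (insert v X)).card := by
    have h4 : ({s(v, a), s(v, b), s(v, c)} : Finset (Sym2 V)).card = 3 := by
      rw [card_eq_three]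
      exact ⟨_, _, _, by simp; grind,
        by simp; grind,
        by simp; grind, rfl⟩
    rw [← h4, ← card_union_of_disjoint]
    · apply card_le_card
      intro e
      simp only [iE, mem_union, mem_filter, mem_insert, mem_singleton]
      rintro (⟨h, h'⟩ | rfl | rfl | rfl)
      · exact ⟨h, h'.trans (subset_insert _ _)⟩
      all_goals simp [*, sv_mk, insert_subset_iff]
    · rw [disjoint_left]
      intro e he he'
      have := (mem_filter.1 he).2
      simp only [mem_insert, mem_singleton] at he'
      rcases he' with rfl | rfl | rfl <;> simp [sv_mk, insert_subset_iff, hX] at this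
  unfold Tight at ht; omega

lemma three {I : Finset V} {E : Finset (Sym2 V)} (hg : Good I E) (hs : Sparse I E)
    {v a b c : V} (hv : v ∈ I) (hab : a ≠ b) (hac : a ≠ c) (hbc : b ≠ c)
    (hva : s(v, a) ∈ E) (hvb : s(v, b) ∈ E) (hvc : s(v, c) ∈ E) (hI : b ∈ I ∨ c ∈ I)
    {X Y Z : Finset V} (hX : v ∉ X) (hY : v ∉ Y) (hZ : v ∉ Z)
    (haX : a ∈ X) (hbX : b ∈ X) (haY : a ∈ Y) (hcY : c ∈ Y) (hbZ : b ∈ Z) (hcZ : c ∈ Z)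
    (tX : Tight I E X) (tY : Tight I E Y) (tZ : Tight I E Z) : False := by
  have key : ∀ {W : Finset V}, v ∉ W → a ∈ W → b ∈ W → c ∈ W → ¬ Tight I E W :=
    fun h1 h2 h3 h4 => no_tight3 hs hv hab hac hbc hva hvb hvc h1 h2 h3 h4
  have one : ∀ {W W' : Finset V} {x : V}, x ∈ W → x ∈ W' → ¬ 2 ≤ (W ∩ W').card → W ∩ W' = {x} := by
    intro W W' x h1 h2 h3
    have : x ∈ W ∩ W' := mem_inter.2 ⟨h1, h2⟩
    obtain ⟨y, hy⟩ := card_eq_one.1 (show (W ∩ W').card = 1 by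
      have := card_pos.2 ⟨x, this⟩; omega)
    rw [hy] at this ⊢; simp at this; rw [this]
  have hXY : X ∩ Y = {a} := one haX haY fun h =>
    key (W := X ∪ Y) (by simp [*]) (by simp [*]) (by simp [*]) (by simp [*]) (tX.union hs tY h)
  have hXZ : X ∩ Z = {b} := one hbX hbZ fun h =>
    key (W := X ∪ Z) (by simp [*]) (by simp [*]) (by simp [*]) (by simp [*]) (tX.union hs tZ h)
  have hYZ : Y ∩ Z = {c} := one hcY hcZ fun h =>
    key (W := Y ∪ Z) (by simp [*]) (by simp [*]) (by simp [*]) (by simp [*]) (tY.union hs tZ h)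
  refine key (W := (X ∪ Y) ∪ Z) (by simp [*]) (by simp [*]) (by simp [*]) (by simp [*]) ?_
  have h1 := gg_sub I X Y
  have h2 := gg_sub I (X ∪ Y) Z
  rw [hXY, gg_single] at h1
  rw [union_inter_distrib_right, hXZ, hYZ, singleton_union, gg_pair hbc hI] at h2
  have h3 : (iE E X).card + (iE E Y).card + (iE E Z).card ≤ (iE E ((X ∪ Y) ∪ Z)).card := by
    have d : ∀ {W W' : Finset V} {x : V}, W ∩ W' = {x} → Disjoint (iE E W) (iE E W') := by
      intro W W' x h
      rw [disjoint_left]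
      intro e he he'
      have : e ∈ iE E {x} := by
        rw [← h]
        exact mem_filter.2 ⟨(mem_filter.1 he).1, subset_inter (mem_filter.1 he).2 (mem_filter.1 he').2⟩
      rw [iE_single hg] at this; simp at this
    rw [← card_union_of_disjoint (d hXY), ← card_union_of_disjoint]
    · apply card_le_card
      intro e; simp only [iE, mem_union, mem_filter]
      rintro ((h | h) | h)
      · exact ⟨h.1, h.2.trans (subset_union_left.trans subset_union_left)⟩
      · exact ⟨h.1, h.2.trans (subset_union_right.trans subset_union_left)⟩
      · exact ⟨h.1, h.2.trans subset_union_right⟩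
    · rw [disjoint_union_left]; exact ⟨d hXZ, d hYZ⟩
  unfold Tight at *; omega

/-- Some pair of the neighbours can be joined. -/
lemma exists_pair {I : Finset V} {E : Finset (Sym2 V)} (hg : Good I E) (hs : Sparse I E)
    {v a b c : V} (hv : v ∈ I) (hab : a ≠ b) (hac : a ≠ c) (hbc : b ≠ c)
    (ha : a ≠ v) (hb : b ≠ v) (hc : c ≠ v)
    (hva : s(v, a) ∈ E) (hvb : s(v, b) ∈ E) (hvc : s(v, c) ∈ E) :
    ∃ x y z, x ≠ y ∧ x ≠ z ∧ y ≠ z ∧ x ≠ v ∧ y ≠ v ∧ z ≠ v ∧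
      ({s(v, a), s(v, b), s(v, c)} : Finset (Sym2 V)) = {s(v, x), s(v, y), s(v, z)} ∧
      s(x, y) ∉ del E v ∧ Good (I.erase v) (insert s(x, y) (del E v)) ∧
      Sparse (I.erase v) (insert s(x, y) (del E v)) := by
  rcases add_or_tight hg hs hab ha hb with h | ⟨X, hX, haX, hbX, tX⟩
  · exact ⟨a, b, c, hab, hac, hbc, ha, hb, hc, rfl, h⟩
  rcases add_or_tight hg hs hac ha hc with h | ⟨Y, hY, haY, hcY, tY⟩
  · exact ⟨a, c, b, hac, hab, hbc.symm, ha, hc, hb, by ext; simp; tauto, h⟩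
  rcases add_or_tight hg hs hbc hb hc with h | ⟨Z, hZ, hbZ, hcZ, tZ⟩
  · exact ⟨b, c, a, hbc, hab.symm, hac.symm, hb, hc, ha, by ext; simp; tauto, h⟩
  exfalso
  by_cases hI : b ∈ I ∨ c ∈ I
  · exact three hg hs hv hab hac hbc hva hvb hvc hI hX hY hZ haX hbX haY hcY hbZ hcZ tX tY tZ
  by_cases hI' : a ∈ I
  · exact three hg hs hv hab.symm hbc hac hvb hva hvc (Or.inl hI') hX hZ hY hbX haX hbZ hcZ haY hcY tX tZ tY
  push Not at hI
  have hp : ({a, b, c} : Finset V) ∩ I = ∅ := by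
    ext x; simp; rintro (rfl | rfl | rfl); exacts [hI', hI.1, hI.2]
  refine no_tight3 hs hv hab hac hbc hva hvb hvc (X := {a, b, c})
    (by simp [ha.symm, hb.symm, hc.symm]) (by simp) (by simp) (by simp) ?_
  unfold Tight
  rw [gg_pins hp]
  · omega
  · exact (card_pair hab).ge.trans (card_le_card (by intro x; simp; tauto))

lemma exists_deg {I : Finset V} {E : Finset (Sym2 V)} (hg : Good I E) (hs : Sparse I E)
    (hI : I.Nonempty) : ∃ v ∈ I, (E.filter (fun e => v ∈ sym2Verts e)).card ≤ 3 := by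
  by_contra! hcon
  have h1 : 4 * I.card ≤ ∑ v ∈ I, (E.filter (fun e => v ∈ sym2Verts e)).card := by
    rw [mul_comm, ← smul_eq_mul]
    exact card_nsmul_le_sum _ _ _ fun v hv => hcon v hv
  have h2 : ∑ v ∈ I, (E.filter (fun e => v ∈ sym2Verts e)).card
      = ∑ e ∈ E, (I.filter (fun v => v ∈ sym2Verts e)).card :=
    sum_card_bipartiteAbove_eq_sum_card_bipartiteBelow _
  rw [h2] at h1
  have hle : ∀ e ∈ E, (sym2Verts e).card ≤ 2 := by
    intro e _
    induction e with
    | _ a b => exact card_le_two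
  have h3 : ∀ e ∈ E, (I.filter (fun v => v ∈ sym2Verts e)).card ≤ 2 := by
    intro e he
    exact (card_le_card (fun x hx => (mem_filter.1 hx).2)).trans (hle e he)
  have hE : E.Nonempty := by
    rw [nonempty_iff_ne_empty]; rintro rfl
    have := card_pos.2 hI
    rw [sum_empty] at h1; omega
  set X := edgeVerts E ∪ I with hXdef
  have hsub : ∀ e ∈ E, sym2Verts e ⊆ X := fun e he =>
    (Finset.le_sup (f := sym2Verts) he).trans subset_union_left
  have hX : 2 ≤ X.card := by
    obtain ⟨e, he⟩ := hE
    have := hsub e he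
    have hd := (hg e he).1
    induction e with
    | _ a b =>
      rw [sv_mk] at this
      exact (card_pair (by simpa using hd)).ge.trans (card_le_card this)
  have h4 := hs X hX
  have h5 : iE E X = E := filter_true_of_mem hsub
  have h6 : X ∩ I = I := inter_eq_right.2 subset_union_right
  rw [h5] at h4
  unfold gg at h4
  rw [h6] at h4
  by_cases hp : X \ I = ∅
  · have h7 := sum_le_card_nsmul _ _ _ h3
    rw [hp] at h4
    simp at h4 h7
    omega
  · obtain ⟨q, hq⟩ := nonempty_iff_ne_empty.2 hp
    simp only [hXdef, mem_sdiff, mem_union] at hq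
    have hq1 : q ∈ edgeVerts E := by tauto
    obtain ⟨e, he, hqe⟩ := mem_sup.1 hq1
    have h7 : ∑ e ∈ E, (I.filter (fun v => v ∈ sym2Verts e)).card < ∑ e ∈ E, 2 := by
      apply sum_lt_sum h3
      refine ⟨e, he, lt_of_lt_of_le (card_lt_card ?_) (hle e he)⟩
      rw [ssubset_iff_of_subset (fun x hx => (mem_filter.1 hx).2)]
      exact ⟨q, hqe, by simp [hq.2]⟩
    simp at h7
    omega

/-- rigidity row -/
def R (p : V → ℝ × ℝ) (e : Sym2 V) (u : V) : ℝ × ℝ :=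
  Sym2.lift ⟨fun i j =>
      (if u = i then p i - p j else 0) + (if u = j then p j - p i else 0),
    fun _ _ => add_comm _ _⟩ e

lemma R_mk (p : V → ℝ × ℝ) (i j u : V) : R p s(i, j) u =
    (if u = i then p i - p j else 0) + (if u = j then p j - p i else 0) := rfl

lemma row_eq (p : V → ℝ × ℝ) (I : Finset V) (e : Sym2 V) (u : V) :
    pinnedRow p I e u = if u ∈ I then R p e u else 0 := by
  induction e with
  | _ a b => rfl

lemma R_zero (p : V → ℝ × ℝ) {e : Sym2 V} {u : V} (h : u ∉ sym2Verts e) : R p e u = 0 := by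
  induction e with
  | _ a b =>
    simp [sv_mk] at h
    simp [R_mk, h]

lemma R_congr {p p' : V → ℝ × ℝ} {e : Sym2 V} (u : V) (h : ∀ x ∈ sym2Verts e, p x = p' x) :
    R p e u = R p' e u := by
  induction e with
  | _ a b =>
    simp [sv_mk] at h
    simp [R_mk, h]

/-- stress formulation of independence -/
def Ind (I : Finset V) (E : Finset (Sym2 V)) (p : V → ℝ × ℝ) : Prop :=
  ∀ w : Sym2 V → ℝ, (∀ u ∈ I, ∑ e ∈ E, w e • R p e u = 0) → ∀ e ∈ E, w e = 0

lemma ind_iff (I : Finset V) (E : Finset (Sym2 V)) (p : V → ℝ × ℝ) :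
    Ind I E p ↔ LinearIndependent ℝ (fun e : E => pinnedRow p I e.1) := by
  have : LinearIndependent ℝ (fun e : E => pinnedRow p I e.1) ↔
    LinearIndepOn ℝ (fun e => pinnedRow p I e) (E : Set (Sym2 V)) := Iff.rfl
  rw [this, linearIndepOn_finset_iff]
  refine forall_congr' fun w => imp_congr ?_ Iff.rfl
  rw [funext_iff]
  refine forall_congr' fun u => ?_
  by_cases hu : u ∈ I <;> simp [row_eq, hu]

lemma ind_iff' (I : Finset V) (E : Finset (Sym2 V)) (p : V → ℝ × ℝ) :
    Ind I E p ↔ LinearIndependent ℝ (fun (e : E) (u : I) => R p e.1 u.1) := by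
  have : LinearIndependent ℝ (fun (e : E) (u : I) => R p e.1 u.1) ↔
    LinearIndepOn ℝ (fun e (u : I) => R p e u.1) (E : Set (Sym2 V)) := Iff.rfl
  rw [this, linearIndepOn_finset_iff]
  refine forall_congr' fun w => imp_congr ?_ Iff.rfl
  rw [funext_iff]
  simp

lemma Ind.perturb {I : Finset V} {E : Finset (Sym2 V)} {p : V → ℝ × ℝ} (h : Ind I E p)
    (q : V → ℝ × ℝ) : {t : ℝ | Ind I E (p + t • q)}.Infinite := by
  have hc : Continuous (fun t : ℝ => (fun (e : E) (u : I) => R (p + t • q) e.1 u.1)) := by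
    refine continuous_pi fun e => continuous_pi fun u => ?_
    obtain ⟨e, he⟩ := e
    induction e with
    | _ a b =>
      simp only [R_mk, Pi.add_apply, Pi.smul_apply]
      split_ifs <;> fun_prop
  have h0 : LinearIndependent ℝ (fun (e : E) (u : I) => R (p + (0 : ℝ) • q) e.1 u.1) := by
    rw [← ind_iff']; simpa using h
  have h1 := hc.continuousAt.eventually h0.eventually
  refine infinite_of_mem_nhds (0 : ℝ) ?_
  filter_upwards [h1] with t ht
  exact (ind_iff' _ _ _).2 ht

lemma Ind.pair {I : Finset V} {E : Finset (Sym2 V)} {p : V → ℝ × ℝ} (h : Ind I E p)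
    {a b : V} (hab : a ≠ b) : ∃ p', Ind I E p' ∧ p' a ≠ p' b := by
  obtain ⟨t, ht, ht'⟩ := (h.perturb (fun x => if x = b then (1, 0) else 0)).exists_notMem_finset
    {(p a).1 - (p b).1}
  refine ⟨_, ht, fun h => ht' ?_⟩
  have := congrArg Prod.fst h
  simp [hab] at this
  simp; linarith

/-- planar determinant of a triple -/
def tri (p : V → ℝ × ℝ) (a b c : V) : ℝ :=
  ((p b).1 - (p a).1) * ((p c).2 - (p a).2) - ((p b).2 - (p a).2) * ((p c).1 - (p a).1)

lemma Ind.triple {I : Finset V} {E : Finset (Sym2 V)} {p : V → ℝ × ℝ} (h : Ind I E p)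
    {a b c : V} (hab : a ≠ b) (hac : a ≠ c) (hbc : b ≠ c) :
    ∃ p', Ind I E p' ∧ tri p' a b c ≠ 0 := by
  let q : V → ℝ × ℝ := fun x => if x = b then (1, 0) else if x = c then (0, 1) else 0
  let f : Polynomial ℝ := .X ^ 2 + (.C ((p b).1 - (p a).1 + ((p c).2 - (p a).2)) * .X + .C (tri p a b c))
  have hf : f ≠ 0 := by
    apply Polynomial.Monic.ne_zero
    apply Polynomial.monic_X_pow_add
    exact lt_of_le_of_lt Polynomial.degree_linear_le (by norm_num)
  obtain ⟨t, ht, ht'⟩ := (h.perturb q).exists_notMem_finset f.roots.toFinset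
  refine ⟨_, ht, fun h => ht' ?_⟩
  rw [Multiset.mem_toFinset, Polynomial.mem_roots hf]
  simp only [f, Polynomial.IsRoot, tri] at h ⊢
  simp [q, hab, hac, hbc.symm] at h ⊢
  linear_combination h

lemma ext_local {I : Finset V} {E : Finset (Sym2 V)} {p : V → ℝ × ℝ} {v : V} (hv : v ∈ I)
    (h : Ind (I.erase v) (del E v) p)
    (h2 : ∀ w : Sym2 V → ℝ, ∑ e ∈ E.filter (fun e => v ∈ sym2Verts e), w e • R p e v = 0 →
      ∀ e ∈ E.filter (fun e => v ∈ sym2Verts e), w e = 0) : Ind I E p := by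
  intro w hw
  have hz := h2 w (by
    rw [← hw v hv]
    apply sum_subset (filter_subset _ _)
    intro e he he'
    rw [R_zero, smul_zero]
    intro hve; exact he' (mem_filter.2 ⟨he, hve⟩))
  have := h w (by
    intro u hu
    rw [← hw u (mem_of_mem_erase hu)]
    apply sum_subset (filter_subset _ _)
    intro e he he'
    have : v ∈ sym2Verts e := by
      by_contra hc; exact he' (mem_filter.2 ⟨he, hc⟩)
    rw [hz e (mem_filter.2 ⟨he, this⟩), zero_smul])
  intro e he
  by_cases hve : v ∈ sym2Verts e
  · exact hz e (mem_filter.2 ⟨he, hve⟩)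
  · exact this e (mem_filter.2 ⟨he, hve⟩)

lemma Ind.update {I : Finset V} {E : Finset (Sym2 V)} {p : V → ℝ × ℝ} (h : Ind I E p) {v : V}
    (hE : ∀ e ∈ E, v ∉ sym2Verts e) (x : ℝ × ℝ) : Ind I E (Function.update p v x) := by
  intro w hw
  apply h w
  intro u hu
  rw [← hw u hu]
  refine sum_congr rfl fun e he => ?_
  rw [R_congr]
  intro y hy
  rw [Function.update_of_ne]
  rintro rfl; exact hE e he hy

lemma del_notMem {E : Finset (Sym2 V)} {v : V} : ∀ e ∈ del E v, v ∉ sym2Verts e :=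
  fun _ he => (mem_filter.1 he).2

lemma ext_three {I : Finset V} {E : Finset (Sym2 V)} {p : V → ℝ × ℝ} {v a b c : V} (hv : v ∈ I)
    (hab : a ≠ b) (hac : a ≠ c) (hbc : b ≠ c) (ha : a ≠ v) (hb : b ≠ v) (hc : c ≠ v)
    (hEv : E.filter (fun e => v ∈ sym2Verts e) = {s(v, a), s(v, b), s(v, c)})
    (hn : s(a, b) ∉ del E v)
    (h : Ind (I.erase v) (insert s(a, b) (del E v)) p) (ht : tri p a b c ≠ 0) :
    ∃ p', Ind I E p' := by
  let p' := Function.update p v ((1 / 2 : ℝ) • (p a + p b))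
  have h' : Ind (I.erase v) (insert s(a, b) (del E v)) p' := by
    apply h.update
    intro e he
    rcases mem_insert.1 he with rfl | he
    · simp [sv_mk, ha.symm, hb.symm]
    · exact del_notMem e he
  have hpv : p' v = (1 / 2 : ℝ) • (p a + p b) := by simp [p']
  have hpa : p' a = p a := by simp [p', ha]
  have hpb : p' b = p b := by simp [p', hb]
  have hpc : p' c = p c := by simp [p', hc]
  refine ⟨p', ?_⟩
  intro w hw
  have hsplit : ∀ u, ∑ e ∈ E, w e • R p' e u = w s(v, a) • R p' s(v, a) u +
      (w s(v, b) • R p' s(v, b) u + w s(v, c) • R p' s(v, c) u) +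
      ∑ e ∈ del E v, w e • R p' e u := by
    intro u
    rw [← sum_filter_add_sum_filter_not E (fun e => v ∈ sym2Verts e), hEv]
    rw [sum_insert (by simp; grind), sum_insert (by simp; grind), sum_singleton]
    rfl
  have hdv : ∑ e ∈ del E v, w e • R p' e v = 0 := by
    apply sum_eq_zero
    intro e he
    rw [R_zero _ (del_notMem e he), smul_zero]
  have hv0 := hw v hv
  rw [hsplit, hdv] at hv0
  simp only [R_mk, ha.symm, hb.symm, hc.symm, if_true, if_false, add_zero, hpv, hpa, hpb, hpc] at hv0
  have e1 := congrArg Prod.fst hv0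
  have e2 := congrArg Prod.snd hv0
  simp at e1 e2
  unfold tri at ht
  have hwc : w s(v, c) = 0 := by
    have : w s(v, c) * (((p b).1 - (p a).1) * ((p c).2 - (p a).2) - ((p b).2 - (p a).2) * ((p c).1 - (p a).1)) = 0 := by
      linear_combination ((p b).2 - (p a).2) * e1 - ((p b).1 - (p a).1) * e2
    exact (mul_eq_zero.1 this).resolve_right ht
  rw [hwc] at e1 e2
  have hwab : w s(v, a) = w s(v, b) := by
    have : (w s(v, a) - w s(v, b)) * (((p b).1 - (p a).1) * ((p c).2 - (p a).2) - ((p b).2 - (p a).2) * ((p c).1 - (p a).1)) = 0 := by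
      linear_combination 2 * ((p c).2 - (p a).2) * e1 - 2 * ((p c).1 - (p a).1) * e2
    have := (mul_eq_zero.1 this).resolve_right ht
    linarith
  let w' : Sym2 V → ℝ := fun e => if e = s(a, b) then w s(v, b) / 2 else w e
  have hz := h' w' (by
    intro u hu
    rw [← hw u (mem_of_mem_erase hu), hsplit, sum_insert hn]
    congr 1
    · have huv : u ≠ v := (mem_erase.1 hu).1
      simp only [w', if_true, hwc, hwab, zero_smul, add_zero, R_mk, huv, if_false, zero_add, hpa, hpb, hpv]
      by_cases h1 : u = a
      · subst h1
        simp only [hab, if_true, if_false]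
        ext <;> simp <;> ring
      · by_cases h2 : u = b
        · subst h2
          simp only [h1, if_true, if_false]
          ext <;> simp <;> ring
        · simp [h1, h2]
    · refine sum_congr rfl fun e he => ?_
      have : e ≠ s(a, b) := by rintro rfl; exact hn he
      simp [w', this])
  have hb0 : w s(v, b) = 0 := by
    have := hz s(a, b) (mem_insert_self _ _)
    simp [w'] at this
    exact this
  intro e he
  by_cases hve : v ∈ sym2Verts e
  · have : e ∈ ({s(v, a), s(v, b), s(v, c)} : Finset (Sym2 V)) := by
      rw [← hEv]; exact mem_filter.2 ⟨he, hve⟩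
    simp only [mem_insert, mem_singleton] at this
    rcases this with rfl | rfl | rfl
    · rw [hwab, hb0]
    · exact hb0
    · exact hwc
  · have hd : e ∈ del E v := mem_filter.2 ⟨he, hve⟩
    have := hz e (mem_insert_of_mem hd)
    have hne : e ≠ s(a, b) := by rintro rfl; exact hn hd
    simpa [w', hne] using this

theorem exists_ind (n : ℕ) : ∀ (I : Finset V) (E : Finset (Sym2 V)), I.card = n → Good I E →
    Sparse I E → ∃ p : V → ℝ × ℝ, Ind I E p := by
  induction n with
  | zero =>
    intro I E hI hg _
    refine ⟨0, fun w _ e he => ?_⟩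
    obtain ⟨_, u, _, hu⟩ := hg e he
    rw [card_eq_zero.1 hI] at hu; simp at hu
  | succ n ih =>
    intro I E hI hg hs
    obtain ⟨v, hv, hd⟩ := exists_deg hg hs (card_pos.1 (by omega))
    have hI' : (I.erase v).card = n := by rw [card_erase_of_mem hv]; omega
    obtain ⟨p, hp⟩ := ih (I.erase v) (del E v) hI' (hg.del v) (hs.del hg v)
    have hedge : ∀ e ∈ E.filter (fun e => v ∈ sym2Verts e), ∃ a, a ≠ v ∧ e = s(v, a) := by
      intro e he
      obtain ⟨he, hve⟩ := mem_filter.1 he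
      obtain ⟨a, rfl⟩ := mem_sv.1 hve
      refine ⟨a, ?_, rfl⟩
      rintro rfl
      exact (hg _ he).1 (by simp)
    obtain h0 | h1 | h2 | h3 : (E.filter (fun e => v ∈ sym2Verts e)).card = 0 ∨
      (E.filter (fun e => v ∈ sym2Verts e)).card = 1 ∨
      (E.filter (fun e => v ∈ sym2Verts e)).card = 2 ∨
      (E.filter (fun e => v ∈ sym2Verts e)).card = 3 := by omega
    · refine ⟨p, ext_local hv hp ?_⟩
      rw [card_eq_zero.1 h0]; simp
    · obtain ⟨e, he⟩ := card_eq_one.1 h1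
      obtain ⟨a, ha, rfl⟩ := hedge e (by rw [he]; simp)
      refine ⟨_, ext_local hv (hp.update del_notMem (p a + (1, 0))) ?_⟩
      rw [he]
      simp [R_mk, ha, ha.symm]
    · obtain ⟨e, f, hef, he⟩ := card_eq_two.1 h2
      obtain ⟨a, ha, rfl⟩ := hedge e (by rw [he]; simp)
      obtain ⟨b, hb, rfl⟩ := hedge f (by rw [he]; simp)
      have hab : a ≠ b := by rintro rfl; exact hef rfl
      obtain ⟨p, hp, hpab⟩ := hp.pair hab
      refine ⟨_, ext_local hv (hp.update del_notMem
        (p a + (-((p b).2 - (p a).2), (p b).1 - (p a).1))) ?_⟩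
      rw [he]
      intro w hw
      rw [sum_pair hef] at hw
      simp [R_mk, ha, ha.symm, hb, hb.symm] at hw ⊢
      obtain ⟨e1, e2⟩ := Prod.ext_iff.1 hw
      simp at e1 e2
      have hne : ((p b).1 - (p a).1) ^ 2 + ((p b).2 - (p a).2) ^ 2 ≠ 0 := by
        intro h
        apply hpab
        ext <;> nlinarith [sq_nonneg ((p b).1 - (p a).1), sq_nonneg ((p b).2 - (p a).2)]
      have k2 : w s(v, b) * (((p b).1 - (p a).1) ^ 2 + ((p b).2 - (p a).2) ^ 2) = 0 := by
        linear_combination -((p b).1 - (p a).1) * e1 - ((p b).2 - (p a).2) * e2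
      have k2' := (mul_eq_zero.1 k2).resolve_right hne
      rw [k2'] at e1 e2
      have k1 : w s(v, a) * (((p b).1 - (p a).1) ^ 2 + ((p b).2 - (p a).2) ^ 2) = 0 := by
        linear_combination -((p b).2 - (p a).2) * e1 + ((p b).1 - (p a).1) * e2
      exact ⟨(mul_eq_zero.1 k1).resolve_right hne, k2'⟩
    · obtain ⟨e, f, g, hef, heg, hfg, he⟩ := card_eq_three.1 h3
      obtain ⟨a, ha, rfl⟩ := hedge e (by rw [he]; simp)
      obtain ⟨b, hb, rfl⟩ := hedge f (by rw [he]; simp)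
      obtain ⟨c, hc, rfl⟩ := hedge g (by rw [he]; simp)
      have hab : a ≠ b := by rintro rfl; exact hef rfl
      have hac : a ≠ c := by rintro rfl; exact heg rfl
      have hbc : b ≠ c := by rintro rfl; exact hfg rfl
      have hmem : ∀ e ∈ ({s(v, a), s(v, b), s(v, c)} : Finset (Sym2 V)), e ∈ E := by
        rw [← he]; exact fun e he => (mem_filter.1 he).1
      obtain ⟨x, y, z, hxy, hxz, hyz, hx, hy, hz, heq, hn, hg', hs'⟩ :=
        exists_pair hg hs hv hab hac hbc ha hb hc (hmem _ (by simp)) (hmem _ (by simp))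
          (hmem _ (by simp))
      obtain ⟨q, hq⟩ := ih _ _ hI' hg' hs'
      obtain ⟨q, hq, ht⟩ := hq.triple hxy hxz hyz
      exact ext_three hv hxy hxz hyz hx hy hz (he.trans heq) hn hq ht

lemma Ind.restrict {I : Finset V} {E E' : Finset (Sym2 V)} {p : V → ℝ × ℝ} (h : Ind I E p)
    (hE : E' ⊆ E) : Ind (edgeVerts E' ∩ I) E' p := by
  intro w hw e he
  have := h (fun e => if e ∈ E' then w e else 0) (by
    intro u hu
    have h1 : ∑ e ∈ E, (if e ∈ E' then w e else 0) • R p e u = ∑ e ∈ E', w e • R p e u := by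
      rw [← sum_subset hE]
      · exact sum_congr rfl fun e he => by simp [he]
      · intro e _ he; simp [he]
    rw [h1]
    by_cases hx : u ∈ edgeVerts E'
    · exact hw u (mem_inter.2 ⟨hx, hu⟩)
    · apply sum_eq_zero
      intro e he
      rw [R_zero, smul_zero]
      intro hc
      exact hx (mem_sup.2 ⟨e, he, hc⟩)) e (hE he)
  simpa [he] using this

lemma Ind.ne_zero {I : Finset V} {E : Finset (Sym2 V)} {p : V → ℝ × ℝ} (h : Ind I E p)
    {e : Sym2 V} (he : e ∈ E) : ∃ u ∈ I, R p e u ≠ 0 := by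
  by_contra! hc
  have := h (Pi.single e 1) (by
    intro u hu
    apply sum_eq_zero
    intro f _
    by_cases hf : f = e
    · subst hf; rw [hc u hu, smul_zero]
    · simp [hf]) e he
  simp at this

lemma Ind.bound {I : Finset V} {E : Finset (Sym2 V)} {p : V → ℝ × ℝ} (h : Ind I E p)
    {F : Type} [AddCommGroup F] [Module ℝ F] (T : (I → ℝ × ℝ) →ₗ[ℝ] F)
    (hT : Function.Surjective T) (hk : ∀ e ∈ E, T (fun u => R p e u.1) = 0) :
    E.card + Module.finrank ℝ F ≤ 2 * I.card := by
  have h1 := (ind_iff' _ _ _).1 h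
  have h2 : LinearIndependent ℝ (fun e : E => (⟨fun u : I => R p e.1 u.1, hk e.1 e.2⟩ : LinearMap.ker T)) :=
    LinearIndependent.of_comp (LinearMap.ker T).subtype h1
  have h3 := h2.fintype_card_le_finrank
  have h4 := LinearMap.finrank_range_add_finrank_ker T
  rw [LinearMap.range_eq_top.2 hT, finrank_top] at h4
  have h5 : Module.finrank ℝ (I → ℝ × ℝ) = 2 * I.card := by
    rw [Module.finrank_pi_fintype]; simp [mul_comm]
  simp at h3
  omega

/-- linear functional assembled from local functionals -/
noncomputable def TT (I : Finset V) (f : V → (ℝ × ℝ →ₗ[ℝ] ℝ)) : (I → ℝ × ℝ) →ₗ[ℝ] ℝ :=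
  ∑ u : I, (f u.1) ∘ₗ (LinearMap.proj u)

lemma TT_apply (I : Finset V) (f : V → (ℝ × ℝ →ₗ[ℝ] ℝ)) (y : I → ℝ × ℝ) :
    TT I f y = ∑ u : I, f u.1 (y u) := by
  simp [TT]

lemma TT_single (I : Finset V) (f : V → (ℝ × ℝ →ₗ[ℝ] ℝ)) (a : I) (z : ℝ × ℝ) :
    TT I f (Pi.single a z) = f a.1 z := by
  rw [TT_apply, Finset.sum_eq_single a]
  · simp
  · intro b _ hb; simp [hb]
  · simp

lemma TT_row (I : Finset V) (f : V → (ℝ × ℝ →ₗ[ℝ] ℝ)) (p : V → ℝ × ℝ) (a b : V) :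
    TT I f (fun u => R p s(a, b) u.1) =
      (if a ∈ I then f a (p a - p b) else 0) + (if b ∈ I then f b (p b - p a) else 0) := by
  rw [TT_apply, Finset.sum_coe_sort I (fun u => f u (R p s(a, b) u))]
  simp only [R_mk, map_add, sum_add_distrib]
  congr 1
  · rw [← Finset.sum_ite_eq' I a (fun u => f a (p a - p b))]
    refine sum_congr rfl fun u _ => ?_
    split_ifs with h
    · rw [h]
    · simp
  · rw [← Finset.sum_ite_eq' I b (fun u => f b (p b - p a))]
    refine sum_congr rfl fun u _ => ?_
    split_ifs with h
    · rw [h]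
    · simp

/-- infinitesimal rotation about q -/
noncomputable def rot (p : V → ℝ × ℝ) (q : ℝ × ℝ) (u : V) : ℝ × ℝ →ₗ[ℝ] ℝ :=
  ((p u).1 - q.1) • LinearMap.snd ℝ ℝ ℝ - ((p u).2 - q.2) • LinearMap.fst ℝ ℝ ℝ

lemma rot_apply (p : V → ℝ × ℝ) (q : ℝ × ℝ) (u : V) (z : ℝ × ℝ) :
    rot p q u z = ((p u).1 - q.1) * z.2 - ((p u).2 - q.2) * z.1 := by
  simp [rot]

lemma bound0 {I : Finset V} {E : Finset (Sym2 V)} {p : V → ℝ × ℝ} (h : Ind I E p) :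
    E.card ≤ 2 * I.card := by
  have := h.bound (F := Fin 0 → ℝ) 0 (fun x => ⟨0, Subsingleton.elim _ _⟩) (fun _ _ => rfl)
  omega

lemma bound1 {I : Finset V} {E : Finset (Sym2 V)} {p : V → ℝ × ℝ} (h : Ind I E p)
    (hne : E.Nonempty) (q : V) (hq : ∀ e ∈ E, ∀ x ∈ e, x ∈ I ∨ x = q)  :
    E.card + 1 ≤ 2 * I.card := by
  have := h.bound (TT I (rot p (p q))) (by
    apply LinearMap.surjective
    intro h0
    have hall : ∀ u ∈ I, p u = p q := by
      intro u hu
      have h1 := TT_single I (rot p (p q)) ⟨u, hu⟩ (0, 1)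
      have h2 := TT_single I (rot p (p q)) ⟨u, hu⟩ (1, 0)
      rw [h0, rot_apply] at h1 h2
      simp at h1 h2
      ext <;> linarith
    obtain ⟨e, he⟩ := hne
    obtain ⟨u, _, hr⟩ := h.ne_zero he
    apply hr
    have hx : ∀ x ∈ e, p x = p q := by
      intro x hx
      rcases hq e he x hx with h | h
      · exact hall x h
      · rw [h]
    induction e with
    | _ a b => simp [R_mk, hx a, hx b]) (by
    intro e he
    have := hq e he
    induction e with
    | _ a b =>
      rw [TT_row]
      simp only [rot_apply]
      rcases this a (by simp) with ha | ha <;> rcases this b (by simp) with hb | hb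
      · simp [ha, hb]; ring
      · subst hb; simp [ha]
        ring
      · subst ha; simp [hb]
        ring
      · subst ha; subst hb; simp)
  simpa using this

lemma bound3 {I : Finset V} {E : Finset (Sym2 V)} {p : V → ℝ × ℝ} (h : Ind I E p)
    (hne : E.Nonempty) (hq : ∀ e ∈ E, ∀ x ∈ e, x ∈ I) :
    E.card + 3 ≤ 2 * I.card := by
  have := h.bound ((TT I (fun _ => LinearMap.fst ℝ ℝ ℝ)).prod
    ((TT I (fun _ => LinearMap.snd ℝ ℝ ℝ)).prod (TT I (rot p 0)))) (by
    obtain ⟨e, he⟩ := hne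
    obtain ⟨u, _, hr⟩ := h.ne_zero he
    have hI := hq e he
    induction e with
    | _ a b =>
      have ha := hI a (by simp)
      have hb := hI b (by simp)
      have hpab : p a ≠ p b := by intro hh; apply hr; simp [R_mk, hh]
      have hne : ((p a).1 - (p b).1) ^ 2 + ((p a).2 - (p b).2) ^ 2 ≠ 0 := by
        intro h
        apply hpab
        ext <;> nlinarith [sq_nonneg ((p a).1 - (p b).1), sq_nonneg ((p a).2 - (p b).2)]
      rintro ⟨s, t, m⟩
      let k : ℝ := (m - ((p b).1 * t - (p b).2 * s)) /
        (((p a).1 - (p b).1) ^ 2 + ((p a).2 - (p b).2) ^ 2)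
      have hk : k * (((p a).1 - (p b).1) ^ 2 + ((p a).2 - (p b).2) ^ 2)
        = m - ((p b).1 * t - (p b).2 * s) := div_mul_cancel₀ _ hne
      refine ⟨(Pi.single (⟨a, ha⟩ : I) ((-k * ((p a).2 - (p b).2), k * ((p a).1 - (p b).1)) : ℝ × ℝ) +
        Pi.single (⟨b, hb⟩ : I) ((s + k * ((p a).2 - (p b).2), t - k * ((p a).1 - (p b).1)) : ℝ × ℝ) :
          I → ℝ × ℝ), ?_⟩
      rw [map_add]
      simp only [LinearMap.prod_apply, Function.prod_apply, TT_single, rot_apply]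
      simp
      linear_combination hk) (by
    intro e he
    have hI := hq e he
    induction e with
    | _ a b =>
      have ha := hI a (by simp)
      have hb := hI b (by simp)
      simp only [LinearMap.prod_apply, Function.prod_apply, TT_row, rot_apply]
      simp [ha, hb]
      try ring)
  simpa using this

lemma edgeVerts_two {I : Finset V} {E : Finset (Sym2 V)} (hg : Good I E) (hne : E.Nonempty) :
    2 ≤ (edgeVerts E).card := by
  obtain ⟨e, he⟩ := hne
  have h1 : sym2Verts e ⊆ edgeVerts E := Finset.le_sup (f := sym2Verts) he
  have hd := (hg e he).1
  induction e with
  | _ a b =>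
    rw [sv_mk] at h1
    exact (card_pair (by simpa using hd)).ge.trans (card_le_card h1)

end PinnedAux

/-- A pinned graph admits a pinned isostatic realization in the plane if and only if it
satisfies the Pinned Framework Conditions. -/
theorem pinned_isostatic_realization_iff {V : Type*} [DecidableEq V]
    (I P : Finset V) (E : Finset (Sym2 V)) (hG : IsPinnedGraph I P E) :
    (∃ p : V → ℝ × ℝ, PinnedIsostatic I E p) ↔ PinnedConditions I P E := by
  have hg : PinnedAux.Good I E := by
    intro e he
    obtain ⟨v, hv⟩ := hG.inner e he
    rw [Finset.mem_inter, PinnedAux.mem_sv] at hv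
    exact ⟨hG.not_diag e he, v, hv.1, hv.2⟩
  have hverts : ∀ E' ⊆ E, ∀ x ∈ edgeVerts E', x ∉ I → x ∈ P := by
    intro E' hE' x hx hxI
    obtain ⟨e, he, hxe⟩ := Finset.mem_sup.1 hx
    have := hG.endpoints e (hE' he) hxe
    rw [Finset.mem_union] at this
    tauto
  have hsd : ∀ E' ⊆ E, edgeVerts E' \ I = edgeVerts E' ∩ P := by
    intro E' hE'
    ext x
    rw [Finset.mem_sdiff, Finset.mem_inter]
    constructor
    · rintro ⟨h1, h2⟩; exact ⟨h1, hverts E' hE' x h1 h2⟩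
    · rintro ⟨h1, h2⟩; exact ⟨h1, fun h => Finset.disjoint_left.1 hG.disj h h2⟩
  constructor
  · rintro ⟨p, hli, hrank⟩
    have hind := (PinnedAux.ind_iff I E p).2 hli
    refine ⟨?_, ?_⟩
    · rw [finrank_span_eq_card hli] at hrank
      simpa using hrank
    · intro E' hE' hne
      have h := hind.restrict hE'
      refine ⟨fun _ => PinnedAux.bound0 h, fun h1 => ?_, fun h0 => ?_⟩
      · obtain ⟨q, hq⟩ := Finset.card_eq_one.1 h1
        have := PinnedAux.bound1 h hne q (by
          intro e he x hx
          have hxv : x ∈ edgeVerts E' := Finset.mem_sup.2 ⟨e, he, PinnedAux.mem_sv.2 hx⟩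
          by_cases hxI : x ∈ I
          · left; exact Finset.mem_inter.2 ⟨hxv, hxI⟩
          · right
            have : x ∈ edgeVerts E' ∩ P := Finset.mem_inter.2 ⟨hxv, hverts E' hE' x hxv hxI⟩
            rw [hq] at this
            simpa using this)
        omega
      · have := PinnedAux.bound3 h hne (by
          intro e he x hx
          have hxv : x ∈ edgeVerts E' := Finset.mem_sup.2 ⟨e, he, PinnedAux.mem_sv.2 hx⟩
          by_cases hxI : x ∈ I
          · exact Finset.mem_inter.2 ⟨hxv, hxI⟩
          · have : x ∈ edgeVerts E' ∩ P := Finset.mem_inter.2 ⟨hxv, hverts E' hE' x hxv hxI⟩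
            rw [h0] at this
            simp at this)
        omega
  · rintro ⟨hcard, hcond⟩
    have hs : PinnedAux.Sparse I E := by
      intro X hX
      rcases (PinnedAux.iE E X).eq_empty_or_nonempty with h0 | hne
      · rw [h0]; simpa using PinnedAux.gg_ge hX
      · have hsub : PinnedAux.iE E X ⊆ E := Finset.filter_subset _ _
        have hvX : edgeVerts (PinnedAux.iE E X) ⊆ X :=
          Finset.sup_le fun e he => (Finset.mem_filter.1 he).2
        refine le_trans ?_ (PinnedAux.gg_mono hvX)
        have h2 := PinnedAux.edgeVerts_two (fun e he => hg e (hsub he)) hne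
        have h3 := PinnedAux.card_split I (edgeVerts (PinnedAux.iE E X))
        obtain ⟨c2, c1, c0⟩ := hcond _ hsub hne
        unfold PinnedAux.gg
        rw [hsd _ hsub] at h3 ⊢
        rw [← Finset.card_eq_zero] at c0
        omega
    obtain ⟨p, hp⟩ := PinnedAux.exists_ind I.card I E rfl hg hs
    have hli := (PinnedAux.ind_iff I E p).1 hp
    refine ⟨p, hli, ?_⟩
    rw [finrank_span_eq_card hli]
    simpa using hcard
end

section
/- Let G(I,P;E) be an Assur graph. Fix a realization p placing the pins at points of ℝ² with at least two distinct locations and placing the inner vertices at points whose 2|I| coordinates are algebraically independent over the field generated over ℚ by the coordinates of the pins. Then for every edge e ∈ E, the pinned rigidity matrix of the pinned graph G(I,P;E ∖ {e}) at p has a kernel vector m : I → ℝ² with m(v) ≠ 0 for every inner vertex v ∈ I; that is, deletion of any edge results in an infinitesimal motion of all inner vertices. -/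
/-- The edge set of the pinned subgraph induced by inner vertices `I'` and pinned
vertices `P'`: the edges with both endpoints in `I' ∪ P'` and at least one endpoint
in `I'`. -/
def inducedEdges {V : Type*} [DecidableEq V] (I' P' : Finset V)
    (E : Finset (Sym2 V)) : Finset (Sym2 V) :=
  E.filter (fun e => sym2Verts e ⊆ I' ∪ P' ∧ (sym2Verts e ∩ I').Nonempty)

/-- Minimality of a pinned graph `G(I,P;E)`: every proper subset of vertices
`I' ∪ P' ⊊ I ∪ P` (with `I' ⊆ I`, `P' ⊆ P`) induces a pinned subgraph with
`|E'| ≤ 2|I'| - 1` edges. -/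
def IsMinimalPinned {V : Type*} [DecidableEq V] (I P : Finset V)
    (E : Finset (Sym2 V)) : Prop :=
  ∀ I' ⊆ I, ∀ P' ⊆ P, I' ∪ P' ⊂ I ∪ P →
    (inducedEdges I' P' E).card ≤ 2 * I'.card - 1

/-- The set of coordinates of the pinned vertices under a realization `p`. -/
def pinCoords {V : Type*} (P : Finset V) (p : V → ℝ × ℝ) : Set ℝ :=
  {x : ℝ | ∃ v ∈ P, (p v).1 = x ∨ (p v).2 = x}

/-- The inner vertices are placed generically over the pins: their `2|I|` coordinates are
algebraically independent over the field generated over `ℚ` by the pin coordinates. -/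
def GenericOverPins {V : Type*} (I P : Finset V) (p : V → ℝ × ℝ) : Prop :=
  AlgebraicIndependent (IntermediateField.adjoin ℚ (pinCoords P p))
    (fun x : { v // v ∈ I } × Fin 2 => if x.2 = 0 then (p x.1.1).1 else (p x.1.1).2)

/-- The dot product on `ℝ²`. -/
def dot (a b : ℝ × ℝ) : ℝ := a.1 * b.1 + a.2 * b.2

/-- `m` is a kernel vector of the pinned rigidity matrix of the pinned graph with inner
vertices `I` and edge set `E` at the realization `p`: `m` assigns a velocity to each
inner vertex (and `0` to all other vertices), so that for every edge `{i,j}` of `E` the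
corresponding row annihilates `m`, i.e. `(p i - p j) ⬝ (m i - m j) = 0` (where `m` is
taken to be `0` at pinned vertices). -/
def IsKernelVector {V : Type*} [DecidableEq V] (p : V → ℝ × ℝ) (I : Finset V)
    (E : Finset (Sym2 V)) (m : V → ℝ × ℝ) : Prop :=
  (∀ v, v ∉ I → m v = 0) ∧
  ∀ i j : V, s(i, j) ∈ E → dot (p i - p j) (m i - m j) = 0


theorem rado_pairs {k M ι : Type*} [Field k] [AddCommGroup M] [Module k M]
    [FiniteDimensional k M] [Fintype ι] [DecidableEq ι] (N : ℕ) :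
    ∀ (a b : ι → M), {i | a i ≠ b i}.ncard = N →
    (∀ F : Finset ι, F.card ≤ Module.finrank k
      (Submodule.span k (a '' (F : Set ι) ∪ b '' (F : Set ι)))) →
    ∃ c : ι → M, (∀ i, c i = a i ∨ c i = b i) ∧ LinearIndependent k c := by
  classical
  induction N with
  | zero =>
    intro a b hN h
    have hab : a = b := by
      have := (Set.ncard_eq_zero (Set.toFinite _)).1 hN
      funext i
      by_contra hi
      have : i ∈ ({i | a i ≠ b i} : Set ι) := hi
      simp_all
    subst hab
    refine ⟨a, fun i => Or.inl rfl, ?_⟩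
    rw [linearIndependent_iff_card_le_finrank_span]
    have := h Finset.univ
    rw [Set.union_self, Finset.coe_univ, Set.image_univ, Finset.card_univ] at this
    exact this
  | succ N ih =>
    intro a b hN h
    have hne : ({i | a i ≠ b i} : Set ι).Nonempty := by
      rw [← Set.ncard_pos (Set.toFinite _)]; omega
    obtain ⟨i, hi⟩ := hne
    have hi' : a i ≠ b i := hi
    have hcard1 : ({j | Function.update a i (b i) j ≠ b j} : Set ι).ncard = N := by
      have : ({j | Function.update a i (b i) j ≠ b j} : Set ι) = {i | a i ≠ b i} \ {i} := by
        ext j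
        by_cases hj : j = i
        · subst hj; simp
        · simp [hj]
      rw [this, Set.ncard_sdiff_singleton_of_mem hi, hN]; rfl
    have hcard2 : ({j | a j ≠ Function.update b i (a i) j} : Set ι).ncard = N := by
      have : ({j | a j ≠ Function.update b i (a i) j} : Set ι) = {i | a i ≠ b i} \ {i} := by
        ext j
        by_cases hj : j = i
        · subst hj; simp
        · simp [hj]
      rw [this, Set.ncard_sdiff_singleton_of_mem hi, hN]; rfl
    by_cases h1 : ∀ F : Finset ι, F.card ≤ Module.finrank k
      (Submodule.span k (Function.update a i (b i) '' (F : Set ι) ∪ b '' (F : Set ι)))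
    · obtain ⟨c, hc, hl⟩ := ih _ _ hcard1 h1
      refine ⟨c, fun j => ?_, hl⟩
      by_cases hj : j = i
      · subst hj; have := hc j; simp at this; exact Or.inr this
      · have := hc j; simpa [hj] using this
    by_cases h2 : ∀ F : Finset ι, F.card ≤ Module.finrank k
      (Submodule.span k (a '' (F : Set ι) ∪ Function.update b i (a i) '' (F : Set ι)))
    · obtain ⟨c, hc, hl⟩ := ih _ _ hcard2 h2
      refine ⟨c, fun j => ?_, hl⟩
      by_cases hj : j = i
      · subst hj; have := hc j; simp at this; exact Or.inl this
      · have := hc j; simpa [hj] using this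
    exfalso
    push Not at h1 h2
    obtain ⟨F1, h1⟩ := h1
    obtain ⟨F2, h2⟩ := h2
    set X := Submodule.span k (Function.update a i (b i) '' (F1 : Set ι) ∪ b '' (F1 : Set ι)) with hX
    set Y := Submodule.span k (a '' (F2 : Set ι) ∪ Function.update b i (a i) '' (F2 : Set ι)) with hY
    have aX : ∀ j ∈ F1, j ≠ i → a j ∈ X := fun j hj hji =>
      Submodule.subset_span (Or.inl ⟨j, hj, by simp [hji]⟩)
    have bX : ∀ j ∈ F1, b j ∈ X := fun j hj =>
      Submodule.subset_span (Or.inr ⟨j, hj, rfl⟩)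
    have aY : ∀ j ∈ F2, a j ∈ Y := fun j hj =>
      Submodule.subset_span (Or.inl ⟨j, hj, rfl⟩)
    have bY : ∀ j ∈ F2, j ≠ i → b j ∈ Y := fun j hj hji =>
      Submodule.subset_span (Or.inr ⟨j, hj, by simp [hji]⟩)
    have key : ∀ (F : Finset ι) (Z : Submodule k M), (∀ j ∈ F, a j ∈ Z) → (∀ j ∈ F, b j ∈ Z) →
        F.card ≤ Module.finrank k Z := by
      intro F Z ha hb
      refine (h F).trans (Submodule.finrank_mono (Submodule.span_le.2 ?_))
      rintro _ (⟨j, hj, rfl⟩ | ⟨j, hj, rfl⟩)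
      · exact ha j hj
      · exact hb j hj
    have i1 : i ∈ F1 := by
      by_contra hn
      have := key F1 X (fun j hj => aX j hj (fun h => hn (h ▸ hj))) bX
      omega
    have i2 : i ∈ F2 := by
      by_contra hn
      have := key F2 Y aY (fun j hj => bY j hj (fun h => hn (h ▸ hj)))
      omega
    have hu := key (F1 ∪ F2) (X ⊔ Y) (by
        intro j hj
        by_cases hji : j = i
        · subst hji; exact Submodule.mem_sup_right (aY _ i2)
        · rcases Finset.mem_union.1 hj with hj | hj
          · exact Submodule.mem_sup_left (aX j hj hji)
          · exact Submodule.mem_sup_right (aY j hj)) (by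
        intro j hj
        by_cases hji : j = i
        · subst hji; exact Submodule.mem_sup_left (bX _ i1)
        · rcases Finset.mem_union.1 hj with hj | hj
          · exact Submodule.mem_sup_left (bX j hj)
          · exact Submodule.mem_sup_right (bY j hj hji))
    have hn := key ((F1 ∩ F2).erase i) (X ⊓ Y) (by
        intro j hj
        simp only [Finset.mem_erase, Finset.mem_inter] at hj
        exact ⟨aX j hj.2.1 hj.1, aY j hj.2.2⟩) (by
        intro j hj
        simp only [Finset.mem_erase, Finset.mem_inter] at hj
        exact ⟨bX j hj.2.1, bY j hj.2.2 hj.1⟩)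
    rw [Finset.card_erase_of_mem (Finset.mem_inter.2 ⟨i1, i2⟩)] at hn
    have e1 := Submodule.finrank_sup_add_finrank_inf_eq X Y
    have e2 := Finset.card_union_add_card_inter F1 F2
    have e3 : 0 < (F1 ∩ F2).card := Finset.card_pos.2 ⟨i, Finset.mem_inter.2 ⟨i1, i2⟩⟩
    omega

theorem finrank_span_lower {J α : Type*} [Fintype J] [Fintype α] (w : α → J → ℝ) (S : Finset J)
    (h : ∀ q : J → ℝ, (∀ i, w i ⬝ᵥ q = 0) → (∀ j ∈ S, q j = 0) → q = 0) :
    Fintype.card J ≤ Module.finrank ℝ (Submodule.span ℝ (Set.range w)) + S.card := by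
  classical
  have h1 := (Matrix.of w).mulVecLin.finrank_range_add_finrank_ker
  have h2 : Module.finrank ℝ (Submodule.span ℝ (Set.range w))
      = Module.finrank ℝ (LinearMap.range (Matrix.of w).mulVecLin) := by
    have := Matrix.rank_eq_finrank_span_row (Matrix.of w)
    exact this.symm
  have h3 : Module.finrank ℝ (LinearMap.ker (Matrix.of w).mulVecLin) ≤ S.card := by
    let L : (J → ℝ) →ₗ[ℝ] (S → ℝ) := LinearMap.funLeft ℝ ℝ (fun j : S => j.1)
    have hinj : Function.Injective (L.comp (LinearMap.ker (Matrix.of w).mulVecLin).subtype) := by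
      rw [← LinearMap.ker_eq_bot, LinearMap.ker_eq_bot']
      rintro ⟨q, hq⟩ hL
      have hq' : Matrix.mulVec (Matrix.of w) q = 0 := hq
      have : q = 0 := by
        apply h q
        · intro i; exact congrFun hq' i
        · intro j hj; exact congrFun hL ⟨j, hj⟩
      exact Subtype.ext this
    have := LinearMap.finrank_le_finrank_of_injective hinj
    simpa using this
  rw [h2]
  simp only [Module.finrank_fintype_fun_eq_card] at h1
  omega

section Rows
variable {I ι : Type*} [Fintype I] [DecidableEq I]

/-- Homogenized direction row. -/
noncomputable def erow (src : ι → I) (tgt : ι → I ⊕ (Fin 2 → ℝ)) (k : Fin 2) (f : ι) :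
    Option (I × Fin 2) → ℝ
  | none => - Sum.elim (fun _ => 0) (fun x => x k) (tgt f)
  | some (v, l) => if l = k then ((if v = src f then 1 else 0) -
      Sum.elim (fun u => if v = u then 1 else 0) (fun _ => 0) (tgt f)) else 0

/-- Homogenized position. -/
def epos (q : Option (I × Fin 2) → ℝ) (t : I ⊕ (Fin 2 → ℝ)) (k : Fin 2) : ℝ :=
  Sum.elim (fun v => q (some (v, k))) (fun x => q none * x k) t

theorem erow_dot (src : ι → I) (tgt : ι → I ⊕ (Fin 2 → ℝ)) (k : Fin 2) (f : ι)
    (q : Option (I × Fin 2) → ℝ) :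
    erow src tgt k f ⬝ᵥ q = q (some (src f, k)) - epos q (tgt f) k := by
  rw [dotProduct, Fintype.sum_option, Fintype.sum_prod_type_right]
  rcases h : tgt f with v | x
  · simp [erow, epos, h, sub_mul, Finset.sum_sub_distrib, ite_mul]
  · simp [erow, epos, h]
    ring

/-- inner endpoints -/
noncomputable def innr (src : ι → I) (tgt : ι → I ⊕ (Fin 2 → ℝ)) (F : Finset ι) : Finset I :=
  open Classical in Finset.univ.filter (fun v => ∃ f ∈ F, src f = v ∨ tgt f = Sum.inl v)

/-- span of the rows -/
noncomputable def rowSpan (src : ι → I) (tgt : ι → I ⊕ (Fin 2 → ℝ)) (F : Finset ι) :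
    Submodule ℝ (Option (I × Fin 2) → ℝ) :=
  Submodule.span ℝ (erow src tgt 0 '' (F : Set ι) ∪ erow src tgt 1 '' (F : Set ι))

/-- the counts -/
structure Counts (src : ι → I) (tgt : ι → I ⊕ (Fin 2 → ℝ)) : Prop where
  two : ∀ F : Finset ι, F.Nonempty → F.card ≤ 2 * (innr src tgt F).card
  one : ∀ F : Finset ι, F.Nonempty → (∃ c, ∀ f ∈ F, ∀ x, tgt f = Sum.inr x → x = c) →
    F.card + 1 ≤ 2 * (innr src tgt F).card
  zero : ∀ F : Finset ι, F.Nonempty → (∀ f ∈ F, ∀ x, tgt f ≠ Sum.inr x) →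
    F.card + 3 ≤ 2 * (innr src tgt F).card

theorem lower_of_set (src : ι → I) (tgt : ι → I ⊕ (Fin 2 → ℝ)) (F : Finset ι)
    (S : Finset (Option (I × Fin 2)))
    (h : ∀ q, (∀ f ∈ F, ∀ k, q (some (src f, k)) = epos q (tgt f) k) →
      (∀ v ∉ innr src tgt F, ∀ k, q (some (v, k)) = 0) → (∀ j ∈ S, q j = 0) → q = 0) :
    2 * (innr src tgt F).card + 1 ≤ Module.finrank ℝ (rowSpan src tgt F) + S.card := by
  classical
  have := finrank_span_lower (fun i : F × Fin 2 => erow src tgt i.2 i.1.1)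
    ((((innr src tgt F)ᶜ ×ˢ (Finset.univ : Finset (Fin 2))).map Function.Embedding.some) ∪ S) (by
      intro q h1 h2
      apply h q
      · intro f hf k
        have := h1 (⟨f, hf⟩, k)
        rw [erow_dot] at this
        exact sub_eq_zero.1 this
      · intro v hv k
        apply h2
        apply Finset.mem_union_left
        simp [hv]
      · intro j hj
        exact h2 j (Finset.mem_union_right _ hj))
  have hc := Finset.card_union_le
    (((innr src tgt F)ᶜ ×ˢ (Finset.univ : Finset (Fin 2))).map Function.Embedding.some) S
  rw [Finset.card_map, Finset.card_product, Finset.card_compl] at hc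
  have hle : (innr src tgt F).card ≤ Fintype.card I := Finset.card_le_univ _
  have hs : Submodule.span ℝ (Set.range (fun i : F × Fin 2 => erow src tgt i.2 i.1.1))
      = rowSpan src tgt F := by
    unfold rowSpan
    congr 1
    ext w
    constructor
    · rintro ⟨⟨⟨f, hf⟩, k⟩, rfl⟩
      fin_cases k
      · exact Or.inl ⟨f, hf, rfl⟩
      · exact Or.inr ⟨f, hf, rfl⟩
    · rintro (⟨f, hf, rfl⟩ | ⟨f, hf, rfl⟩)
      · exact ⟨(⟨f, hf⟩, 0), rfl⟩
      · exact ⟨(⟨f, hf⟩, 1), rfl⟩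
  rw [hs] at this
  simp only [Fintype.card_option, Fintype.card_prod, Fintype.card_fin, Finset.card_univ] at this hc
  omega

theorem connected_case (src : ι → I) (tgt : ι → I ⊕ (Fin 2 → ℝ)) (hC : Counts src tgt)
    (F : Finset ι) (hF : F.Nonempty) (v0 : I)
    (hv : ∀ q, (∀ f ∈ F, ∀ k, q (some (src f, k)) = epos q (tgt f) k) →
      ∀ f ∈ F, ∀ k, q (some (src f, k)) = q (some (v0, k))) :
    F.card + 1 ≤ Module.finrank ℝ (rowSpan src tgt F) := by
  classical
  have hall : ∀ q, (∀ f ∈ F, ∀ k, q (some (src f, k)) = epos q (tgt f) k) →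
      ∀ v ∈ innr src tgt F, ∀ k, q (some (v, k)) = q (some (v0, k)) := by
    intro q hq v hvi k
    simp only [innr, Finset.mem_filter, Finset.mem_univ, true_and] at hvi
    obtain ⟨f, hf, h | h⟩ := hvi
    · rw [← h]; exact hv q hq f hf k
    · rw [← hv q hq f hf k, hq f hf k, h]; rfl
  have concl : ∀ q, (∀ f ∈ F, ∀ k, q (some (src f, k)) = epos q (tgt f) k) →
      (∀ v ∉ innr src tgt F, ∀ k, q (some (v, k)) = 0) → q none = 0 →
      (∀ k, q (some (v0, k)) = 0) → q = 0 := by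
    intro q h1 h2 h3 h4
    funext j
    rcases j with _ | ⟨v, k⟩
    · exact h3
    · by_cases hvi : v ∈ innr src tgt F
      · rw [hall q h1 v hvi k, h4]; rfl
      · exact h2 v hvi k
  by_cases h0 : ∀ f ∈ F, ∀ x, tgt f ≠ Sum.inr x
  · have h := lower_of_set src tgt F {none, some (v0, 0), some (v0, 1)} (by
      intro q h1 h2 h3
      refine concl q h1 h2 (h3 _ (by simp)) ?_
      intro k
      fin_cases k
      · exact h3 _ (by simp)
      · exact h3 _ (by simp))
    have hc : ({none, some (v0, 0), some (v0, 1)} : Finset (Option (I × Fin 2))).card ≤ 3 :=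
      Finset.card_le_three
    have := hC.zero F hF h0
    omega
  push Not at h0
  obtain ⟨f0, hf0, x0, hx0⟩ := h0
  have pin : ∀ q, (∀ f ∈ F, ∀ k, q (some (src f, k)) = epos q (tgt f) k) →
      ∀ f ∈ F, ∀ x, tgt f = Sum.inr x → ∀ k, q (some (v0, k)) = q none * x k := by
    intro q hq f hf x hx k
    rw [← hv q hq f hf k, hq f hf k, hx]; rfl
  by_cases h1 : ∃ c, ∀ f ∈ F, ∀ x, tgt f = Sum.inr x → x = c
  · have h := lower_of_set src tgt F {none} (by
      intro q h1 h2 h3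
      have hn := h3 none (by simp)
      refine concl q h1 h2 hn ?_
      intro k
      rw [pin q h1 f0 hf0 x0 hx0 k, hn, zero_mul])
    have := hC.one F hF h1
    simp at h
    omega
  · push Not at h1
    obtain ⟨f1, hf1, x1, hx1, hne⟩ := h1 x0
    have h := lower_of_set src tgt F ∅ (by
      intro q h1 h2 _
      have hn : q none = 0 := by
        by_contra hn
        apply hne
        funext k
        have e1 := pin q h1 f0 hf0 x0 hx0 k
        have e2 := pin q h1 f1 hf1 x1 hx1 k
        exact mul_left_cancel₀ hn (e2.symm.trans e1)
      refine concl q h1 h2 hn ?_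
      intro k
      rw [pin q h1 f0 hf0 x0 hx0 k, hn, zero_mul])
    have := hC.two F hF
    simp at h
    omega

theorem rowSpan_supp (src : ι → I) (tgt : ι → I ⊕ (Fin 2 → ℝ)) (F : Finset ι)
    (w : Option (I × Fin 2) → ℝ) (hw : w ∈ rowSpan src tgt F) (v : I) (hv : v ∉ innr src tgt F)
    (l : Fin 2) : w (some (v, l)) = 0 := by
  classical
  have hle : rowSpan src tgt F ≤ LinearMap.ker (LinearMap.proj (R := ℝ)
      (φ := fun _ : Option (I × Fin 2) => ℝ) (some (v, l))) := by
    refine Submodule.span_le.2 ?_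
    have key : ∀ k, ∀ f ∈ F, erow src tgt k f (some (v, l)) = 0 := by
      intro k f hf
      simp only [innr, Finset.mem_filter, Finset.mem_univ, true_and, not_exists, not_and,
        not_or] at hv
      obtain ⟨h1, h2⟩ := hv f hf
      rcases h : tgt f with u | x
      · have : v ≠ u := by rintro rfl; exact h2 h
        simp [erow, h, this, Ne.symm h1]
      · simp [erow, h, Ne.symm h1]
    rintro _ (⟨f, hf, rfl⟩ | ⟨f, hf, rfl⟩)
    · exact key 0 f hf
    · exact key 1 f hf
  exact hle hw

theorem rowSpan_mono {I ι : Type*} [DecidableEq I] (src : ι → I) (tgt : ι → I ⊕ (Fin 2 → ℝ)) {F G : Finset ι} (h : F ⊆ G) :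
    rowSpan src tgt F ≤ rowSpan src tgt G :=
  Submodule.span_mono (Set.union_subset_union (Set.image_mono (by exact_mod_cast h))
    (Set.image_mono (by exact_mod_cast h)))

theorem rowSpan_card (src : ι → I) (tgt : ι → I ⊕ (Fin 2 → ℝ)) (hC : Counts src tgt) (N : ℕ) :
    ∀ F : Finset ι, F.card = N → F.Nonempty →
      F.card + 1 ≤ Module.finrank ℝ (rowSpan src tgt F) := by
  classical
  induction N using Nat.strong_induction_on with
  | _ N ih =>
  intro F hN hF
  obtain ⟨f0, hf0⟩ := hF
  let T := F.filter (fun f => ∀ q : Option (I × Fin 2) → ℝ,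
    (∀ f ∈ F, ∀ k, q (some (src f, k)) = epos q (tgt f) k) →
      ∀ k, q (some (src f, k)) = q (some (src f0, k)))
  have hT : ∀ f, f ∈ T ↔ f ∈ F ∧ ∀ q : Option (I × Fin 2) → ℝ,
    (∀ f ∈ F, ∀ k, q (some (src f, k)) = epos q (tgt f) k) →
      ∀ k, q (some (src f, k)) = q (some (src f0, k)) := fun f => Finset.mem_filter
  by_cases hTF : F \ T = ∅
  · refine connected_case src tgt hC F ⟨f0, hf0⟩ (src f0) ?_
    intro q hq f hf k
    have : f ∈ T := (Finset.sdiff_eq_empty_iff_subset.1 hTF) hf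
    exact ((hT f).1 this).2 q hq k
  have hTs : T ⊆ F := Finset.filter_subset _ _
  have hf0T : f0 ∈ T := (hT f0).2 ⟨hf0, fun _ _ _ => rfl⟩
  have hne := Finset.nonempty_iff_ne_empty.2 hTF
  have hcard := Finset.card_sdiff_add_card_eq_card hTs
  have hp1 : 0 < T.card := Finset.card_pos.2 ⟨f0, hf0T⟩
  have hp2 : 0 < (F \ T).card := Finset.card_pos.2 hne
  have i1 := ih T.card (by omega) T rfl ⟨f0, hf0T⟩
  have i2 := ih (F \ T).card (by omega) (F \ T) rfl hne
  have hdisj : ∀ v, v ∈ innr src tgt T → v ∉ innr src tgt (F \ T) := by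
    intro v h1 h2
    simp only [innr, Finset.mem_filter, Finset.mem_univ, true_and] at h1 h2
    obtain ⟨f, hf, hfv⟩ := h1
    obtain ⟨g, hg, hgv⟩ := h2
    rw [Finset.mem_sdiff] at hg
    apply hg.2
    refine (hT g).2 ⟨hg.1, ?_⟩
    intro q hq k
    have aux : ∀ f ∈ F, (src f = v ∨ tgt f = Sum.inl v) →
        q (some (src f, k)) = q (some (v, k)) := by
      rintro f hf (h | h)
      · rw [h]
      · rw [hq f hf k, h]; rfl
    rw [aux g hg.1 hgv, ← aux f (hTs hf) hfv]
    exact ((hT f).1 hf).2 q hq k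
  have hinf : Module.finrank ℝ ↥(rowSpan src tgt T ⊓ rowSpan src tgt (F \ T)) ≤ 1 := by
    have hle : rowSpan src tgt T ⊓ rowSpan src tgt (F \ T) ≤
        Submodule.span ℝ {(Pi.single none 1 : Option (I × Fin 2) → ℝ)} := by
      rintro w ⟨h1, h2⟩
      rw [Submodule.mem_span_singleton]
      refine ⟨w none, ?_⟩
      funext j
      rcases j with _ | ⟨v, l⟩
      · simp
      · by_cases hv : v ∈ innr src tgt T
        · rw [rowSpan_supp src tgt _ w h2 v (hdisj v hv) l]; simp
        · rw [rowSpan_supp src tgt _ w h1 v hv l]; simp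
    exact (Submodule.finrank_mono hle).trans (finrank_span_singleton (by simp)).le
  have hsup : rowSpan src tgt T ⊔ rowSpan src tgt (F \ T) ≤ rowSpan src tgt F :=
    sup_le (rowSpan_mono src tgt hTs) (rowSpan_mono src tgt Finset.sdiff_subset)
  have e1 := Submodule.finrank_sup_add_finrank_inf_eq (rowSpan src tgt T) (rowSpan src tgt (F \ T))
  have e2 := Submodule.finrank_mono hsup
  omega



theorem exists_dir [Fintype ι] (src : ι → I) (tgt : ι → I ⊕ (Fin 2 → ℝ)) (hC : Counts src tgt)
    (z : Option (I × Fin 2) → ℝ) (hz : z ≠ 0) :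
    ∃ n : ι × Fin 2 → ℝ, LinearIndependent ℝ (fun o : Option ι => o.elim z
      (fun f => n (f, 0) • erow src tgt 0 f + n (f, 1) • erow src tgt 1 f)) := by
  classical
  obtain ⟨c, hc, hl⟩ := rado_pairs (k := ℝ) _ (fun o : Option ι => o.elim z (erow src tgt 0))
    (fun o : Option ι => o.elim z (erow src tgt 1)) rfl (by
      intro F
      set W := Submodule.span ℝ ((fun o : Option ι => o.elim z (erow src tgt 0)) '' (F : Set (Option ι)) ∪
        (fun o : Option ι => o.elim z (erow src tgt 1)) '' (F : Set (Option ι))) with hW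
      have hsub : F ⊆ insert none (F.eraseNone.map Function.Embedding.some) := by
        intro o ho
        rcases o with _ | f
        · simp
        · simp [ho]
      have hcard := (Finset.card_le_card hsub).trans (Finset.card_insert_le _ _)
      rw [Finset.card_map] at hcard
      by_cases hne : F.eraseNone.Nonempty
      · have h1 := rowSpan_card src tgt hC _ F.eraseNone rfl hne
        have h2 : rowSpan src tgt F.eraseNone ≤ W := by
          refine Submodule.span_mono (Set.union_subset_union ?_ ?_)
          · rintro _ ⟨f, hf, rfl⟩
            exact ⟨some f, by simpa using hf, rfl⟩
          · rintro _ ⟨f, hf, rfl⟩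
            exact ⟨some f, by simpa using hf, rfl⟩
        have := Submodule.finrank_mono h2
        omega
      · rw [Finset.not_nonempty_iff_eq_empty] at hne
        rw [hne, Finset.card_empty] at hcard
        by_cases hF : none ∈ F
        · have hzW : Submodule.span ℝ {z} ≤ W := by
            rw [Submodule.span_singleton_le_iff_mem]
            exact Submodule.subset_span (Or.inl ⟨none, hF, rfl⟩)
          have := Submodule.finrank_mono hzW
          rw [finrank_span_singleton hz] at this
          omega
        · have : F = ∅ := by
            rw [Finset.eq_empty_iff_forall_notMem]
            rintro (_ | f) hf
            · exact hF hf
            · have : f ∈ F.eraseNone := by simpa using hf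
              simp [hne] at this
          simp [this])
  refine ⟨fun x => if c (some x.1) = erow src tgt x.2 x.1 then
    (if x.2 = 0 then 1 else if c (some x.1) = erow src tgt 0 x.1 then 0 else 1) else 0, ?_⟩
  have gen : ∀ c' : Option ι → Option (I × Fin 2) → ℝ, c' = c → LinearIndependent ℝ c' := by
    rintro _ rfl
    exact hl
  refine gen _ ?_
  funext o
  rcases o with _ | f
  · have := hc none
    simp at this
    exact this.symm
  · have h := hc (some f)
    simp only [Option.elim_some] at h
    by_cases h0 : c (some f) = erow src tgt 0 f
    · simp [← h0]
    · have h1 := h.resolve_left h0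
      simp [h0, ← h1]

theorem det_ne_of_linearIndependent {A J : Type*} [Fintype A] [DecidableEq A] [Fintype J]
    (σ : A ≃ J) (w : A → J → ℝ) (h : LinearIndependent ℝ w) :
    (Matrix.of (fun a b => w a (σ b))).det ≠ 0 := by
  have h2 := h.map' (LinearEquiv.funCongrLeft ℝ ℝ σ).toLinearMap (LinearEquiv.ker _)
  have h3 : LinearIndependent ℝ (Matrix.of (fun a b => w a (σ b))).row := h2
  rw [Matrix.linearIndependent_rows_iff_isUnit, Matrix.isUnit_iff_isUnit_det] at h3
  exact h3.ne_zero

theorem dot_reindex {A J : Type*} [Fintype A] [Fintype J]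
    (σ : A ≃ J) (w : A → J → ℝ) (q : J → ℝ) (a : A) :
    ((Matrix.of (fun a b => w a (σ b))).mulVec (q ∘ σ)) a = w a ⬝ᵥ q := by
  simp only [Matrix.mulVec, dotProduct, Matrix.of_apply, Function.comp]
  exact Equiv.sum_comp σ (fun j => w a j * q j)

theorem exists_common_dir [Fintype ι] (src : ι → I) (tgt : ι → I ⊕ (Fin 2 → ℝ))
    (hC : Counts src tgt) {κ : Type*} [Fintype κ] (hcard : Fintype.card ι = 2 * Fintype.card I)
    (z : κ → Option (I × Fin 2) → ℝ) (hz : ∀ κ, z κ ≠ 0) :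
    ∃ n : ι × Fin 2 → ℝ, ∀ i : κ, 
      (∀ q, z i ⬝ᵥ q = 0 → (∀ f, (n (f, 0) • erow src tgt 0 f + n (f, 1) • erow src tgt 1 f) ⬝ᵥ q = 0)
        → q = 0) ∧
      ∃ q, z i ⬝ᵥ q = 1 ∧ ∀ f, (n (f, 0) • erow src tgt 0 f + n (f, 1) • erow src tgt 1 f) ⬝ᵥ q = 0 := by
  classical
  have σ : Option ι ≃ Option (I × Fin 2) := Fintype.equivOfCardEq (by simp [hcard, mul_comm])
  let w : κ → (ι × Fin 2 → ℝ) → Option ι → Option (I × Fin 2) → ℝ := fun i n o => o.elim (z i)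
      (fun f => n (f, 0) • erow src tgt 0 f + n (f, 1) • erow src tgt 1 f)
  let Q : κ → Matrix (Option ι) (Option ι) (MvPolynomial (ι × Fin 2) ℝ) := fun i => Matrix.of
    fun o b => o.elim (MvPolynomial.C (z i (σ b))) (fun f =>
      MvPolynomial.X (f, 0) * MvPolynomial.C (erow src tgt 0 f (σ b)) +
      MvPolynomial.X (f, 1) * MvPolynomial.C (erow src tgt 1 f (σ b)))
  have hQ : ∀ i n, MvPolynomial.eval n (Q i).det = (Matrix.of (fun a b => w i n a (σ b))).det := by
    intro i n
    rw [RingHom.map_det]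
    congr 1
    ext o b
    rcases o with _ | f
    · simp [Q, w]
    · simp [Q, w]
  have hne : ∏ i, (Q i).det ≠ 0 := by
    rw [Finset.prod_ne_zero_iff]
    intro i _ h0
    obtain ⟨n, hn⟩ := exists_dir src tgt hC (z i) (hz i)
    apply det_ne_of_linearIndependent σ _ hn
    have := hQ i n
    rw [h0, map_zero] at this
    exact this.symm
  have hex : ∃ n, MvPolynomial.eval n (∏ i, (Q i).det) ≠ 0 := by
    by_contra hcon
    push Not at hcon
    exact hne (MvPolynomial.funext (by simpa using hcon))
  obtain ⟨n, hn⟩ := hex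
  refine ⟨n, fun i => ?_⟩
  rw [map_prod, Finset.prod_ne_zero_iff] at hn
  have hd := hn i (Finset.mem_univ _)
  rw [hQ] at hd
  constructor
  · intro q h1 h2
    have h0 := Matrix.eq_zero_of_mulVec_eq_zero hd (v := q ∘ σ) (by
      funext o
      rw [dot_reindex]
      rcases o with _ | f
      · exact h1
      · exact h2 f)
    funext j
    have := congrFun h0 (σ.symm j)
    simpa using this
  · set M := (Matrix.of (fun a b => w i n a (σ b)))
    let q' : Option ι → ℝ := M⁻¹.mulVec (Pi.single none 1)
    have hq' : M.mulVec q' = Pi.single none 1 := by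
      simp only [q', Matrix.mulVec_mulVec]
      rw [Matrix.mul_nonsing_inv _ (Ne.isUnit hd), Matrix.one_mulVec]
    have hqq : (q' ∘ σ.symm) ∘ σ = q' := by funext a; simp
    have hdot : ∀ o, w i n o ⬝ᵥ (q' ∘ σ.symm) = (Pi.single none 1 : Option ι → ℝ) o := by
      intro o
      rw [← dot_reindex σ, hqq]
      exact congrFun hq' o
    refine ⟨q' ∘ σ.symm, ?_, ?_⟩
    · have := hdot none
      rw [Pi.single_eq_same] at this
      exact this
    · intro f
      have := hdot (some f)
      rw [Pi.single_eq_of_ne (by simp)] at this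
      exact this

theorem erow_zero_ne (src : ι → I) (tgt : ι → I ⊕ (Fin 2 → ℝ))
    (hC : Counts src tgt) (f : ι) : erow src tgt 0 f ≠ 0 := by
  intro h
  have h1 := rowSpan_card src tgt hC 1 {f} (by simp) (by simp)
  have h2 : rowSpan src tgt {f} ≤ Submodule.span ℝ {erow src tgt 1 f} := by
    refine Submodule.span_le.2 ?_
    rintro _ (⟨g, hg, rfl⟩ | ⟨g, hg, rfl⟩)
    · simp at hg; subst hg; rw [h]; exact Submodule.zero_mem _
    · simp at hg; subst hg; exact Submodule.mem_span_singleton_self _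
  have h3 := Submodule.finrank_mono h2
  have h4 := finrank_span_le_card (R := ℝ) ({erow src tgt 1 f} : Set (Option (I × Fin 2) → ℝ))
  simp at h4 h1
  omega

/-- The kernel of the pinned rigidity matrix at `p` is trivial. -/
def KerTriv (src : ι → I) (tgt : ι → I ⊕ (Fin 2 → ℝ)) (p : I × Fin 2 → ℝ) : Prop :=
  ∀ m : I × Fin 2 → ℝ, (∀ f, ∑ k, (p (src f, k) - Sum.elim (fun v => p (v, k)) (fun x => x k) (tgt f))
    * (m (src f, k) - Sum.elim (fun v => m (v, k)) (fun _ => 0) (tgt f)) = 0) → m = 0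

theorem laman_exists [Fintype ι] (src : ι → I) (tgt : ι → I ⊕ (Fin 2 → ℝ))
    (hC : Counts src tgt) (hcard : Fintype.card ι = 2 * Fintype.card I) :
    ∃ p, KerTriv src tgt p := by
  classical
  obtain ⟨n, hn⟩ := exists_common_dir src tgt hC hcard
    (fun o : Option ι => o.elim (Pi.single none 1) (erow src tgt 0)) (by
      rintro (_ | f)
      · simp
      · exact erow_zero_ne src tgt hC f)
  obtain ⟨hn1, q, hq1, hq2⟩ := hn none
  simp only [Option.elim_none, single_dotProduct, one_mul] at hn1 hq1
  refine ⟨fun x => q (some x), ?_⟩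
  intro m hm
  let m' : Option (I × Fin 2) → ℝ := fun o => o.elim 0 (fun x => if x.2 = 0 then - m (x.1, 1) else m (x.1, 0))
  have hm' : m' = 0 := by
    apply hn1
    · rfl
    · intro f
      have h1 := hm f
      have h2 := hq2 f
      have h3 : erow src tgt 0 f ⬝ᵥ q ≠ 0 := by
        intro h0
        have := (hn (some f)).1 q h0 hq2
        rw [this] at hq1
        simp at hq1
      simp only [add_dotProduct, smul_dotProduct, erow_dot, smul_eq_mul, Fin.sum_univ_two] at h1 h2 h3 ⊢
      have key : ∀ n0 n1 d0 d1 w0 w1 : ℝ, d0 ≠ 0 → n0 * d0 + n1 * d1 = 0 → d0 * w0 + d1 * w1 = 0 →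
          n0 * (-w1) + n1 * w0 = 0 := by
        intro n0 n1 d0 d1 w0 w1 h h' h''
        apply mul_left_cancel₀ h
        linear_combination (-w1) * h' + n1 * h''
      have hk := key _ _ _ _ (m (src f, 0) - Sum.elim (fun v => m (v, 0)) (fun _ => 0) (tgt f))
         (m (src f, 1) - Sum.elim (fun v => m (v, 1)) (fun _ => 0) (tgt f)) h3 h2 (by
          rcases h : tgt f with v | x
          · simpa [epos, h] using h1
          · simpa [epos, h, hq1] using h1)
      rcases h : tgt f with v | x
      · simp [epos, m', h] at hk ⊢
        linarith
      · simp [epos, m', h] at hk ⊢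
        linarith
  funext ⟨v, k⟩
  fin_cases k
  · have := congrFun hm' (some (v, 1)); simpa [m'] using this
  · have := congrFun hm' (some (v, 0)); simpa [m'] using this

/-- Polynomial rigidity matrix over a commutative ring. -/
def rigMat {R : Type*} [CommRing R] (src : ι → I) (tgt : ι → I ⊕ (Fin 2 → R)) (p : I × Fin 2 → R) :
    Matrix ι (I × Fin 2) R :=
  Matrix.of fun f x => (p (src f, x.2) - Sum.elim (fun v => p (v, x.2)) (fun y => y x.2) (tgt f)) *
    ((if x.1 = src f then 1 else 0) - Sum.elim (fun u => if x.1 = u then 1 else 0) (fun _ => 0) (tgt f))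

theorem rigMat_mulVec (src : ι → I) (tgt : ι → I ⊕ (Fin 2 → ℝ)) (p m : I × Fin 2 → ℝ) (f : ι) :
    (rigMat src tgt p).mulVec m f = ∑ k, (p (src f, k) - Sum.elim (fun v => p (v, k)) (fun x => x k) (tgt f))
    * (m (src f, k) - Sum.elim (fun v => m (v, k)) (fun _ => 0) (tgt f)) := by
  rw [Matrix.mulVec, dotProduct, Fintype.sum_prod_type_right]
  refine Finset.sum_congr rfl fun k _ => ?_
  simp only [rigMat, Matrix.of_apply, mul_assoc]
  rw [← Finset.mul_sum]
  congr 1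
  rcases h : tgt f with v | x
  · simp [sub_mul, Finset.sum_sub_distrib, ite_mul]
  · simp

theorem kerTriv_generic [Fintype ι] (src : ι → I) (tgt : ι → I ⊕ (Fin 2 → ℝ))
    (hC : Counts src tgt) (hcard : Fintype.card ι = 2 * Fintype.card I)
    (K : IntermediateField ℚ ℝ) (hK : ∀ f x, tgt f = Sum.inr x → ∀ k, x k ∈ K)
    (g : I × Fin 2 → ℝ) (hg : AlgebraicIndependent K g) : KerTriv src tgt g := by
  classical
  have ρ : ι ≃ I × Fin 2 := Fintype.equivOfCardEq (by simp [hcard, mul_comm])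
  have hT : ∀ f, ∃ t : I ⊕ (Fin 2 → K), tgt f = Sum.map id (fun x k => (x k : ℝ)) t := by
    intro f
    rcases h : tgt f with v | x
    · exact ⟨Sum.inl v, rfl⟩
    · exact ⟨Sum.inr fun k => ⟨x k, hK f x h k⟩, rfl⟩
  choose t ht using hT
  let Q : Matrix ι ι (MvPolynomial (I × Fin 2) K) :=
    (rigMat src (fun f => Sum.map id (fun x k => MvPolynomial.C (x k)) (t f)) MvPolynomial.X).submatrix id ρ
  have hQ : ∀ p : I × Fin 2 → ℝ, MvPolynomial.aeval p Q.det =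
      ((rigMat src tgt p).submatrix id ρ).det := by
    intro p
    rw [AlgHom.map_det]
    congr 1
    ext f b
    rcases h : t f with v | x
    · by_cases h1 : (ρ b).1 = src f <;> by_cases h2 : (ρ b).1 = v <;>
        simp [Q, rigMat, ht, h, h1, h2]
    · by_cases h1 : (ρ b).1 = src f <;> simp [Q, rigMat, ht, h, h1]
  have hker : ∀ p : I × Fin 2 → ℝ, KerTriv src tgt p ↔ ((rigMat src tgt p).submatrix id ρ).det ≠ 0 := by
    intro p
    have hmv : ∀ (m : I × Fin 2 → ℝ) f, ((rigMat src tgt p).submatrix id ρ).mulVec (m ∘ ρ) f =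
        (rigMat src tgt p).mulVec m f := by
      intro m f
      simp only [Matrix.mulVec, dotProduct, Matrix.submatrix_apply, Function.comp, id]
      exact Equiv.sum_comp ρ (fun j => rigMat src tgt p f j * m j)
    constructor
    · intro hk h0
      obtain ⟨v, hv, hv0⟩ := Matrix.exists_mulVec_eq_zero_iff.2 h0
      apply hv
      have := hk (v ∘ ρ.symm) (by
        intro f
        rw [← rigMat_mulVec, ← hmv]
        have : (v ∘ ρ.symm) ∘ ρ = v := by funext a; simp
        rw [this, hv0]; rfl)
      funext a
      have := congrFun this (ρ a)
      simpa using this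
    · intro hd m hm
      have h0 := Matrix.eq_zero_of_mulVec_eq_zero hd (v := m ∘ ρ) (by
        funext f
        rw [hmv, rigMat_mulVec]
        exact hm f)
      funext j
      have := congrFun h0 (ρ.symm j)
      simpa using this
  obtain ⟨p, hp⟩ := laman_exists src tgt hC hcard
  rw [hker, ← hQ] at hp ⊢
  intro h0
  apply hp
  have : Q.det = 0 := hg (by rw [h0, map_zero])
  rw [this, map_zero]

end Rows

/-- coordinates of a point -/
def crd (a : ℝ × ℝ) (k : Fin 2) : ℝ := if k = 0 then a.1 else a.2

theorem crd_inj {a b : ℝ × ℝ} (h : crd a = crd b) : a = b := by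
  have h0 := congrFun h 0
  have h1 := congrFun h 1
  simp [crd] at h0 h1
  exact Prod.ext h0 h1

theorem mem_sym2Verts {V : Type*} [DecidableEq V] (i j v : V) :
    v ∈ sym2Verts s(i, j) ↔ v = i ∨ v = j := by
  simp [sym2Verts]

theorem mem_edgeVerts {V : Type*} [DecidableEq V] (F : Finset (Sym2 V)) (v : V) :
    v ∈ edgeVerts F ↔ ∃ f ∈ F, v ∈ sym2Verts f := by
  simp [edgeVerts, Finset.mem_sup]

/-- Counting consequences of the Assur property for subsets of `E \ {e}`. -/
theorem assur_counts {V : Type*} [DecidableEq V]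
    (I P : Finset V) (E : Finset (Sym2 V)) (hG : IsPinnedGraph I P E)
    (hPFC : PinnedConditions I P E) (hmin : IsMinimalPinned I P E) (e : Sym2 V) (he : e ∈ E)
    (F : Finset (Sym2 V)) (hF : F ⊆ E.erase e) (hne : F.Nonempty) :
    F.card + 1 ≤ 2 * (edgeVerts F ∩ I).card ∧
    (edgeVerts F ∩ P = ∅ → F.card + 3 ≤ 2 * (edgeVerts F ∩ I).card) := by
  have hFE : F ⊆ E := hF.trans (Finset.erase_subset _ _)
  have hpos : 0 < F.card := Finset.card_pos.2 hne
  constructor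
  · by_cases hs : (edgeVerts F ∩ I) ∪ (edgeVerts F ∩ P) ⊂ I ∪ P
    · have h1 := hmin _ Finset.inter_subset_right _ Finset.inter_subset_right hs
      have h2 : F ⊆ inducedEdges (edgeVerts F ∩ I) (edgeVerts F ∩ P) E := by
        intro f hf
        refine Finset.mem_filter.2 ⟨hFE hf, ?_, ?_⟩
        · intro v hv
          have hv' := (mem_edgeVerts F v).2 ⟨f, hf, hv⟩
          have := hG.endpoints f (hFE hf) hv
          simp only [Finset.mem_union, Finset.mem_inter] at this ⊢
          tauto
        · obtain ⟨v, hv⟩ := hG.inner f (hFE hf)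
          rw [Finset.mem_inter] at hv
          exact ⟨v, by simp [hv.1, hv.2, (mem_edgeVerts F v).2 ⟨f, hf, hv.1⟩]⟩
      have := Finset.card_le_card h2
      omega
    · have hsub : (edgeVerts F ∩ I) ∪ (edgeVerts F ∩ P) ⊆ I ∪ P :=
        Finset.union_subset_union Finset.inter_subset_right Finset.inter_subset_right
      have heq : (edgeVerts F ∩ I) ∪ (edgeVerts F ∩ P) = I ∪ P := by
        by_contra hc
        exact hs (hsub.ssubset_of_ne hc)
      have hI : edgeVerts F ∩ I = I := by
        apply Finset.inter_eq_right.2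
        intro v hv
        have : v ∈ I ∪ P := Finset.mem_union_left _ hv
        rw [← heq] at this
        simp only [Finset.mem_union, Finset.mem_inter] at this
        tauto
      have h1 := Finset.card_le_card hF
      rw [Finset.card_erase_of_mem he, hPFC.1] at h1
      rw [hI]
      omega
  · intro h0
    have := (hPFC.2 F hFE hne).2.2 h0
    omega

theorem exists_new_pin {V : Type*} (P : Finset V) (p : V → ℝ × ℝ) :
    ∃ c : ℚ, ∀ v ∈ P, crd (p v) ≠ fun _ => (c : ℝ) := by
  classical
  have hfin : {c : ℚ | ∃ v ∈ P, crd (p v) = fun _ => (c : ℝ)}.Finite := by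
    have : Set.Finite ((fun c : ℚ => (c : ℝ)) ⁻¹' ((fun v => crd (p v) 0) '' (P : Set V))) :=
      Set.Finite.preimage (Rat.cast_injective.injOn) (P.finite_toSet.image _)
    refine this.subset ?_
    rintro c ⟨v, hv, h⟩
    exact ⟨v, hv, by simp [h]⟩
  obtain ⟨c, hc⟩ := hfin.exists_notMem
  exact ⟨c, fun v hv h => hc ⟨v, hv, h⟩⟩

theorem assur_kernel {V : Type*} [DecidableEq V]
    (I P : Finset V) (E : Finset (Sym2 V)) (hG : IsPinnedGraph I P E)
    (hPFC : PinnedConditions I P E) (hmin : IsMinimalPinned I P E)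
    (p : V → ℝ × ℝ) 
    (hgen : GenericOverPins I P p) (e : Sym2 V) (he : e ∈ E) (v : V) (hv : v ∈ I) :
    ∃ d : ℝ × ℝ, (∃ m : V → ℝ × ℝ, IsKernelVector p I (E.erase e) m ∧ dot d (m v) = 1) ∧
      ∀ m : V → ℝ × ℝ, IsKernelVector p I (E.erase e) m → dot d (m v) = 0 → m = 0 := by
  classical
  obtain ⟨c, hc⟩ := exists_new_pin P p
  have hor : ∀ f : {f // f ∈ E.erase e}, ∃ ij : V × V, f.1 = s(ij.1, ij.2) ∧ ij.1 ∈ I := by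
    rintro ⟨f, hf⟩
    obtain ⟨w, hw⟩ := hG.inner f (Finset.mem_of_mem_erase hf)
    rw [Finset.mem_inter] at hw
    induction f using Sym2.ind with
    | _ i j =>
      rcases (mem_sym2Verts i j w).1 hw.1 with h | h
      · exact ⟨(i, j), rfl, h ▸ hw.2⟩
      · exact ⟨(j, i), Sym2.eq_swap, h ▸ hw.2⟩
  choose ij hij hijI using hor
  have hjP : ∀ f, (ij f).2 ∉ I → (ij f).2 ∈ P := by
    intro f h
    have := hG.endpoints f.1 (Finset.mem_of_mem_erase f.2)
      (show (ij f).2 ∈ sym2Verts f.1 by rw [hij f, mem_sym2Verts]; simp)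
    simp only [Finset.mem_union] at this
    tauto
  let src : Option {f // f ∈ E.erase e} → {v // v ∈ I} := fun o => o.elim ⟨v, hv⟩
    (fun f => ⟨(ij f).1, hijI f⟩)
  let tgt : Option {f // f ∈ E.erase e} → {v // v ∈ I} ⊕ (Fin 2 → ℝ) := fun o =>
    o.elim (Sum.inr fun _ => (c : ℝ))
    (fun f => if h : (ij f).2 ∈ I then Sum.inl ⟨(ij f).2, h⟩ else Sum.inr (crd (p (ij f).2)))
  have tgt_in : ∀ f (h : (ij f).2 ∈ I), tgt (some f) = Sum.inl ⟨(ij f).2, h⟩ := by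
    intro f h; simp [tgt, h]
  have tgt_out : ∀ f (h : (ij f).2 ∉ I), tgt (some f) = Sum.inr (crd (p (ij f).2)) := by
    intro f h; simp [tgt, h]
  have hcardE : (E.erase e).card + 1 = 2 * I.card := by
    rw [Finset.card_erase_add_one he, hPFC.1]
  -- counts
  have hbasic : ∀ F : Finset (Option {f // f ∈ E.erase e}), F.eraseNone.Nonempty →
      F.eraseNone.card + 1 ≤ 2 * (innr src tgt F).card ∧
      ((∀ f ∈ F.eraseNone, (ij f).2 ∈ I) → F.eraseNone.card + 3 ≤ 2 * (innr src tgt F).card) := by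
    intro F hF
    set G : Finset (Sym2 V) := F.eraseNone.map (Function.Embedding.subtype _) with hGdef
    have hGs : G ⊆ E.erase e := by
      intro f hf
      simp only [hGdef, Finset.mem_map, Function.Embedding.coe_subtype] at hf
      obtain ⟨g, _, rfl⟩ := hf
      exact g.2
    have hGc : G.card = F.eraseNone.card := Finset.card_map _
    have hGn : G.Nonempty := hF.map
    have hGv : ∀ w, w ∈ edgeVerts G ↔ ∃ f ∈ F.eraseNone, w = (ij f).1 ∨ w = (ij f).2 := by
      intro w
      rw [mem_edgeVerts]
      constructor
      · rintro ⟨f, hf, hw⟩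
        simp only [hGdef, Finset.mem_map, Function.Embedding.coe_subtype] at hf
        obtain ⟨g, hg, rfl⟩ := hf
        rw [hij g, mem_sym2Verts] at hw
        exact ⟨g, hg, hw⟩
      · rintro ⟨g, hg, hw⟩
        refine ⟨g.1, Finset.mem_map.2 ⟨g, hg, rfl⟩, ?_⟩
        rw [hij g, mem_sym2Verts]
        exact hw
    have hIc : (edgeVerts G ∩ I).card ≤ (innr src tgt F).card := by
      have : edgeVerts G ∩ I ⊆ (innr src tgt F).map (Function.Embedding.subtype _) := by
        intro w hw
        rw [Finset.mem_inter, hGv] at hw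
        obtain ⟨⟨f, hf, hwf⟩, hwI⟩ := hw
        refine Finset.mem_map.2 ⟨⟨w, hwI⟩, ?_, rfl⟩
        simp only [innr, Finset.mem_filter, Finset.mem_univ, true_and]
        refine ⟨some f, Finset.mem_eraseNone.1 hf, ?_⟩
        rcases hwf with h | h
        · left; exact Subtype.ext h.symm
        · right
          subst h
          exact tgt_in f hwI
      exact (Finset.card_le_card this).trans (Finset.card_map _).le
    obtain ⟨h1, h2⟩ := assur_counts I P E hG hPFC hmin e he G hGs hGn
    refine ⟨by omega, fun h => ?_⟩
    have : edgeVerts G ∩ P = ∅ := by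
      rw [Finset.eq_empty_iff_forall_notMem]
      intro w hw
      rw [Finset.mem_inter, hGv] at hw
      obtain ⟨⟨f, hf, hwf⟩, hwP⟩ := hw
      have : w ∈ I := by
        rcases hwf with rfl | rfl
        · exact hijI f
        · exact h f hf
      exact Finset.disjoint_left.1 hG.disj this hwP
    have := h2 this
    omega
  have hFcard : ∀ F : Finset (Option {f // f ∈ E.erase e}),
      (none ∉ F ∧ F.card = F.eraseNone.card) ∨ (none ∈ F ∧ F.card = F.eraseNone.card + 1) := by
    intro F
    have hm : (F.eraseNone.map Function.Embedding.some) = F.erase none :=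
      Finset.map_some_eraseNone F
    have hm' := congrArg Finset.card hm
    rw [Finset.card_map] at hm'
    by_cases h : none ∈ F
    · right
      refine ⟨h, ?_⟩
      rw [hm', Finset.card_erase_add_one h]
    · left
      refine ⟨h, ?_⟩
      rw [hm', Finset.erase_eq_of_notMem h]
  have hinpos : ∀ F : Finset (Option {f // f ∈ E.erase e}), F.Nonempty →
      1 ≤ (innr src tgt F).card := by
    rintro F ⟨f, hf⟩
    refine Finset.card_pos.2 ⟨src f, ?_⟩
    simp only [innr, Finset.mem_filter, Finset.mem_univ, true_and]
    exact ⟨f, hf, Or.inl rfl⟩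
  have hC : Counts src tgt := by
    constructor
    · intro F hF
      have hp := hinpos F hF
      by_cases hn : F.eraseNone.Nonempty
      · have := hbasic F hn
        rcases hFcard F with h | h <;> omega
      · rw [Finset.not_nonempty_iff_eq_empty] at hn
        have hz : F.eraseNone.card = 0 := by simp [hn]
        rcases hFcard F with h | h <;> omega
    · rintro F hF ⟨x, hx⟩
      have hp := hinpos F hF
      by_cases hn : F.eraseNone.Nonempty
      · obtain ⟨h1, h2⟩ := hbasic F hn
        rcases hFcard F with h | h
        · omega
        · have hxc : (fun _ => (c : ℝ)) = x := hx none h.1 _ rfl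
          have := h2 (by
            intro f hf
            by_contra hI
            have e1 := hx (some f) (Finset.mem_eraseNone.1 hf) _ (tgt_out f hI)
            exact hc _ (hjP f hI) (e1.trans hxc.symm))
          omega
      · rw [Finset.not_nonempty_iff_eq_empty] at hn
        have hz : F.eraseNone.card = 0 := by simp [hn]
        rcases hFcard F with h | h <;> omega
    · intro F hF hx
      have hnone : none ∉ F := fun h => hx none h _ rfl
      have hcd : F.card = F.eraseNone.card := by
        rcases hFcard F with h | h
        · exact h.2
        · exact absurd h.1 hnone
      have hn : F.eraseNone.Nonempty := by
        rw [← Finset.card_pos, ← hcd]; exact Finset.card_pos.2 hF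
      have := (hbasic F hn).2 (by
        intro f hf
        by_contra hI
        exact hx (some f) (Finset.mem_eraseNone.1 hf) _ (tgt_out f hI))
      omega
  have hcard : Fintype.card (Option {f // f ∈ E.erase e}) = 2 * Fintype.card {v // v ∈ I} := by
    rw [Fintype.card_option, Fintype.card_coe, Fintype.card_coe, hcardE]
  have hK : ∀ f x, tgt f = Sum.inr x → ∀ k, x k ∈ IntermediateField.adjoin ℚ (pinCoords P p) := by
    rintro (_ | f) x hx k
    · have : (fun _ => (c : ℝ)) = x := Sum.inr.inj hx
      rw [← this]
      have := (IntermediateField.adjoin ℚ (pinCoords P p)).algebraMap_mem c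
      simpa using this
    · by_cases hI : (ij f).2 ∈ I
      · rw [tgt_in f hI] at hx; cases hx
      · rw [tgt_out f hI] at hx
        rw [← Sum.inr.inj hx]
        apply IntermediateField.subset_adjoin
        refine ⟨_, hjP f hI, ?_⟩
        fin_cases k <;> simp [crd]
  have hker := kerTriv_generic src tgt hC hcard _ hK _ hgen
  have hrow : ∀ (m : V → ℝ × ℝ), (∀ w ∉ I, m w = 0) → ∀ o,
      (∑ k, (crd (p (src o).1) k - Sum.elim (fun v => crd (p v.1) k) (fun x => x k) (tgt o))
      * (crd (m (src o).1) k - Sum.elim (fun v => crd (m v.1) k) (fun _ => 0) (tgt o))) =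
      o.elim (dot (p v - ((c : ℝ), (c : ℝ))) (m v))
        (fun f => dot (p (ij f).1 - p (ij f).2) (m (ij f).1 - m (ij f).2)) := by
    intro m hm o
    rcases o with _ | f
    · simp [src, tgt, crd, dot, Fin.sum_univ_two]
    · by_cases hI : (ij f).2 ∈ I
      · rw [tgt_in f hI]; simp [src, crd, dot, Fin.sum_univ_two]
      · rw [tgt_out f hI]; simp [src, crd, dot, Fin.sum_univ_two, hm _ hI]
  have hker2 : ∀ m : V → ℝ × ℝ, IsKernelVector p I (E.erase e) m →
      dot (p v - ((c : ℝ), (c : ℝ))) (m v) = 0 → m = 0 := by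
    intro m hm hmv
    have h0 := hker (fun x => crd (m x.1.1) x.2) (by
      intro o
      refine (hrow m hm.1 o).trans ?_
      rcases o with _ | f
      · exact hmv
      · exact hm.2 _ _ (hij f ▸ f.2))
    funext w
    by_cases hw : w ∈ I
    · apply crd_inj
      funext k
      have := congrFun h0 (⟨w, hw⟩, k)
      simpa [crd] using this
    · exact hm.1 w hw
  refine ⟨p v - ((c : ℝ), (c : ℝ)), ?_, hker2⟩
  -- existence: the square matrix is invertible
  have hinj : Function.Injective (rigMat src tgt
      (fun x : { v // v ∈ I } × Fin 2 => crd (p x.1.1) x.2)).mulVecLin := by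
    rw [← LinearMap.ker_eq_bot, LinearMap.ker_eq_bot']
    intro m hm
    refine hker m ?_
    intro o
    have := congrFun hm o
    rw [Matrix.mulVecLin_apply, rigMat_mulVec] at this
    exact this
  have hsurj := (LinearMap.injective_iff_surjective_of_finrank_eq_finrank (by
    rw [Module.finrank_fintype_fun_eq_card, Module.finrank_fintype_fun_eq_card, hcard]
    simp [mul_comm])).1 hinj
  obtain ⟨m, hm⟩ := hsurj (Pi.single none 1)
  let m' : V → ℝ × ℝ := fun w => if h : w ∈ I then (m (⟨w, h⟩, 0), m (⟨w, h⟩, 1)) else 0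
  have hm'0 : ∀ w ∉ I, m' w = 0 := fun w hw => by simp [m', hw]
  have hm'c : m = fun x => crd (m' x.1.1) x.2 := by
    funext ⟨w, k⟩
    fin_cases k <;> simp [m', crd]
  have hval : ∀ o, o.elim (dot (p v - ((c : ℝ), (c : ℝ))) (m' v))
        (fun f => dot (p (ij f).1 - p (ij f).2) (m' (ij f).1 - m' (ij f).2))
        = (Pi.single none 1 : Option {f // f ∈ E.erase e} → ℝ) o := by
    intro o
    rw [← hrow m' hm'0 o]
    have := congrFun hm o
    rw [Matrix.mulVecLin_apply, rigMat_mulVec, hm'c] at this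
    exact this
  refine ⟨m', ⟨hm'0, ?_⟩, ?_⟩
  · intro i j h
    have := hval (some ⟨s(i, j), h⟩)
    rw [Pi.single_eq_of_ne (by simp)] at this
    simp only [Option.elim_some] at this
    have hh := hij ⟨s(i, j), h⟩
    rcases Sym2.eq_iff.1 hh with ⟨h1, h2⟩ | ⟨h1, h2⟩
    · rw [← h1, ← h2] at this; exact this
    · rw [← h1, ← h2] at this
      rw [← this]
      simp only [dot, Prod.fst_sub, Prod.snd_sub]
      ring
  · simpa using hval none

/-- For an Assur graph realized with the pins at two or more distinct locations and the
inner vertices generic over the pins, deleting any edge yields a pinned framework with an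
infinitesimal motion of all inner vertices: the pinned rigidity matrix of
`G(I,P;E ∖ {e})` has a kernel vector which is nonzero at every inner vertex. -/
theorem assur_edge_deletion_moves_all {V : Type*} [DecidableEq V]
    (I P : Finset V) (E : Finset (Sym2 V)) (hG : IsPinnedGraph I P E)
    (hPFC : PinnedConditions I P E) (hmin : IsMinimalPinned I P E)
    (p : V → ℝ × ℝ) (hpins : ∃ u ∈ P, ∃ w ∈ P, p u ≠ p w)
    (hgen : GenericOverPins I P p) :
    ∀ e ∈ E, ∃ m : V → ℝ × ℝ,
      IsKernelVector p I (E.erase e) m ∧ ∀ v ∈ I, m v ≠ 0 := by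
  intro e he
  obtain ⟨v0, hv0⟩ := hG.inner e he
  rw [Finset.mem_inter] at hv0
  obtain ⟨d, ⟨m, hm, hd⟩, _⟩ := assur_kernel I P E hG hPFC hmin p hgen e he v0 hv0.2
  refine ⟨m, hm, ?_⟩
  intro v hv h0
  obtain ⟨d', _, hd'⟩ := assur_kernel I P E hG hPFC hmin p hgen e he v hv
  have := hd' m hm (by simp [h0, dot])
  rw [this] at hd
  simp [dot] at hd
end
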